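/- For every integer i with 1 ≤ i ≤ e, the 𝔽_p-dimension of V_{pe₁s−s·b^{(i)}}/V_{pe₁s−s·b^{(i)}+1} equals f, and moreover V_{pe₁s−b^{(i−1)}·s} = V_{pe₁s−b^{(i)}·s+1} (with the convention b^{(0)} = 0). -/

import Mathlib

/-- The subgroup of `p`-th powers in `Kˣ`. -/
noncomputable def pthPowers (p : ℕ) (K : Type*) [Field K] : Subgroup Kˣ :=
  (powMonoidHom p : Kˣ →* Kˣ).range

/-- The `𝔽_p`-vector space `Kˣ/(Kˣ)ᵖ`. -/
abbrev KmodP (p : ℕ) (K : Type*) [Field K] :=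
  Kˣ ⧸ pthPowers p K

/-- For `i ≥ 1`, the image `Ū_i` of `U_i = 1 + 𝔓^i` in `Kˣ/(Kˣ)ᵖ`, where `𝔓` is the
maximal ideal of the ring of integers of `K` and `w` is the normalized valuation. -/
def UbarSet (p : ℕ) (K : Type*) [Field K] (w : K → ℤ) (i : ℤ) : Set (KmodP p K) :=
  {c | ∃ x : Kˣ, (QuotientGroup.mk x : KmodP p K) = c ∧
    ∃ u y : K, y ≠ 0 ∧ (u - 1 = 0 ∨ i ≤ w (u - 1)) ∧ (x : K) = u * y ^ p}

/-- The `ω`-eigenspace `V ⊆ Kˣ/(Kˣ)ᵖ` for the natural action of `Δ = Gal(K|F)`: the set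
of classes `x̄` with `σ(x)·x^{−ω(σ)} ∈ (Kˣ)ᵖ` for all `σ ∈ Δ`. -/
def omegaEigenspace (p : ℕ) (F K : Type*) [Field F] [Field K] [Algebra F K]
    (ω : (K ≃ₐ[F] K) → (ZMod p)ˣ) : Set (KmodP p K) :=
  {c | ∃ x : Kˣ, (QuotientGroup.mk x : KmodP p K) = c ∧
    ∀ σ : K ≃ₐ[F] K, ∃ y : K, y ≠ 0 ∧ σ (x : K) = (x : K) ^ (ω σ : ZMod p).val * y ^ p}

/-- `b^(i) = i + ⌊(i−1)/(p−1)⌋` (with the conventions of natural subtraction/division,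
so that `b^(0) = 0`). -/
def bExp (p i : ℕ) : ℕ := i + (i - 1) / (p - 1)

/-- An integer-valued valuation on a field; the value at `0` is left unconstrained. -/
structure IsIntVal {K : Type*} [Field K] (w : K → ℤ) : Prop where
  mul : ∀ x y : K, x ≠ 0 → y ≠ 0 → w (x * y) = w x + w y
  add : ∀ x y : K, x ≠ 0 → y ≠ 0 → x + y ≠ 0 → min (w x) (w y) ≤ w (x + y)

namespace IsIntVal

section Basic

variable {K : Type*} [Field K] {w : K → ℤ}

theorem one (h : IsIntVal w) : w 1 = 0 := by
  have := h.mul 1 1 one_ne_zero one_ne_zero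
  simp only [mul_one] at this
  omega

theorem neg_one (h : IsIntVal w) : w (-1) = 0 := by
  have := h.mul (-1) (-1) (by simp) (by simp)
  simp only [mul_neg, mul_one, neg_neg, h.one] at this
  omega

theorem neg (h : IsIntVal w) (x : K) : w (-x) = w x := by
  by_cases hx : x = 0
  · simp [hx]
  · have := h.mul (-1) x (by simp) hx
    simpa [h.neg_one] using this

theorem inv (h : IsIntVal w) {x : K} (hx : x ≠ 0) : w x⁻¹ = -w x := by
  have := h.mul x x⁻¹ hx (inv_ne_zero hx)
  rw [mul_inv_cancel₀ hx, h.one] at this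
  omega

theorem pow (h : IsIntVal w) {x : K} (hx : x ≠ 0) (n : ℕ) : w (x ^ n) = n * w x := by
  induction n with
  | zero => simp [h.one]
  | succ n ih => rw [pow_succ, h.mul _ _ (pow_ne_zero _ hx) hx, ih]; push_cast; ring

theorem zpow (h : IsIntVal w) {x : K} (hx : x ≠ 0) (n : ℤ) : w (x ^ n) = n * w x := by
  cases n with
  | ofNat n => simpa using h.pow hx n
  | negSucc n =>
    rw [zpow_negSucc, h.inv (pow_ne_zero _ hx), h.pow hx, Int.negSucc_eq]
    push_cast; ring

theorem prod (h : IsIntVal w) {ι : Type*} (s : Finset ι) (f : ι → K) (hf : ∀ i ∈ s, f i ≠ 0) :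
    w (∏ i ∈ s, f i) = ∑ i ∈ s, w (f i) := by
  classical
  induction s using Finset.induction_on with
  | empty => simp [h.one]
  | insert a s ha ih =>
    rw [Finset.prod_insert ha, Finset.sum_insert ha, h.mul, ih]
    · exact fun i hi => hf i (Finset.mem_insert_of_mem hi)
    · exact hf a (Finset.mem_insert_self _ _)
    · exact Finset.prod_ne_zero_iff.2 fun i hi => hf i (Finset.mem_insert_of_mem hi)

theorem comap (h : IsIntVal w) {F : Type*} [Field F] (φ : F →+* K) :
    IsIntVal (fun x => w (φ x)) where
  mul x y hx hy := by
    rw [map_mul]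
    exact h.mul _ _ (by simpa using hx) (by simpa using hy)
  add x y hx hy hxy := by
    rw [map_add]
    exact h.add _ _ (by simpa using hx) (by simpa using hy) (by rwa [← map_add, map_ne_zero])

/-- The fractional ideal of elements of valuation at least `j`. -/
def fil (h : IsIntVal w) (j : ℤ) : AddSubgroup K where
  carrier := {x | x = 0 ∨ j ≤ w x}
  zero_mem' := Or.inl rfl
  neg_mem' {x} hx := by
    rcases hx with hx | hx
    · exact Or.inl (by simp [hx])
    · exact Or.inr (by rwa [h.neg])
  add_mem' {x y} hx hy := by
    rcases hx with hx | hx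
    · rcases hy with hy | hy
      · exact Or.inl (by simp [hx, hy])
      · exact Or.inr (by simpa [hx] using hy)
    · rcases hy with hy | hy
      · exact Or.inr (by simpa [hy] using hx)
      · by_cases hx0 : x = 0
        · exact Or.inr (by simpa [hx0] using hy)
        by_cases hy0 : y = 0
        · exact Or.inr (by simpa [hy0] using hx)
        by_cases hxy : x + y = 0
        · exact Or.inl hxy
        · exact Or.inr ((le_min hx hy).trans (h.add x y hx0 hy0 hxy))

theorem mem_fil (h : IsIntVal w) {j : ℤ} {x : K} : x ∈ h.fil j ↔ x = 0 ∨ j ≤ w x := Iff.rfl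

theorem mem_fil_of_ne_zero (h : IsIntVal w) {j : ℤ} {x : K} (hx : x ≠ 0) :
    x ∈ h.fil j ↔ j ≤ w x := by
  simp [mem_fil, hx]

theorem fil_anti (h : IsIntVal w) {i j : ℤ} (hij : i ≤ j) : h.fil j ≤ h.fil i := by
  rintro x (hx | hx)
  · exact Or.inl hx
  · exact Or.inr (hij.trans hx)

theorem mul_mem (h : IsIntVal w) {i j : ℤ} {x y : K} (hx : x ∈ h.fil i) (hy : y ∈ h.fil j) :
    x * y ∈ h.fil (i + j) := by
  by_cases hx0 : x = 0
  · exact Or.inl (by simp [hx0])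
  by_cases hy0 : y = 0
  · exact Or.inl (by simp [hy0])
  rw [mem_fil_of_ne_zero h (mul_ne_zero hx0 hy0), h.mul _ _ hx0 hy0]
  rw [mem_fil_of_ne_zero h hx0] at hx
  rw [mem_fil_of_ne_zero h hy0] at hy
  omega

theorem one_mem (h : IsIntVal w) : (1 : K) ∈ h.fil 0 := Or.inr h.one.ge

theorem natCast_mem (h : IsIntVal w) (n : ℕ) : (n : K) ∈ h.fil 0 := by
  simpa using nsmul_mem h.one_mem n

theorem intCast_mem (h : IsIntVal w) (n : ℤ) : (n : K) ∈ h.fil 0 := by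
  simpa using zsmul_mem h.one_mem n

theorem mul_mem' (h : IsIntVal w) {j : ℤ} {x y : K} (hx : x ∈ h.fil 0) (hy : y ∈ h.fil j) :
    x * y ∈ h.fil j := by
  simpa using h.mul_mem hx hy

theorem pow_mem (h : IsIntVal w) {j : ℤ} {x : K} (hx : x ∈ h.fil j) (n : ℕ) :
    x ^ n ∈ h.fil (n * j) := by
  induction n with
  | zero => simpa using h.one_mem
  | succ n ih =>
    rw [pow_succ]
    convert h.mul_mem ih hx using 2
    push_cast; ring

theorem pow_mem_zero (h : IsIntVal w) {x : K} (hx : x ∈ h.fil 0) (n : ℕ) :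
    x ^ n ∈ h.fil 0 := by
  simpa using h.pow_mem hx n

/-- If a sum has a strictly dominated summand, its valuation is that of the other one. -/
theorem add_eq_left (h : IsIntVal w) {x y : K} (hx : x ≠ 0) (hy : y ∈ h.fil (w x + 1)) :
    x + y ≠ 0 ∧ w (x + y) = w x := by
  have h1 : x ∉ h.fil (w x + 1) := by
    rw [h.mem_fil_of_ne_zero hx]; omega
  have h2 : x + y ∉ h.fil (w x + 1) := fun hc => h1 (by simpa using sub_mem hc hy)
  have h3 : x + y ≠ 0 := fun hc => h2 (hc ▸ zero_mem _)
  have h4 : x + y ∈ h.fil (w x) :=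
    add_mem (Or.inr le_rfl) (h.fil_anti (by omega) hy)
  rw [h.mem_fil_of_ne_zero h3] at h2 h4
  exact ⟨h3, by omega⟩

/-- An element congruent to `1` is a nonzero element of valuation zero. -/
theorem unit_of_sub_one_mem (h : IsIntVal w) {j : ℤ} (hj : 1 ≤ j) {x : K}
    (hx : x - 1 ∈ h.fil j) : x ≠ 0 ∧ w x = 0 := by
  have := h.add_eq_left one_ne_zero (h.fil_anti (by simpa [h.one] using hj) hx)
  simpa [h.one] using this

end Basic

section Padic

variable {p : ℕ} [hp : Fact p.Prime]

theorem exists_root (m : ℕ) (hm : ¬ p ∣ m) (x : ℤ_[p]) : ∃ z : ℤ_[p], z ^ m = 1 + p * x := by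
  open Polynomial in
  have hm' : ‖(m : ℤ_[p])‖ = 1 := by
    rw [← PadicInt.isUnit_iff]
    by_contra hc
    have := PadicInt.mem_nonunits.1 hc
    exact hm (PadicInt.norm_natCast_lt_one_iff.1 this)
  have := hensels_lemma (p := p) (F := (X ^ m - C (1 + p * x) : ℤ_[p][X])) (a := (1 : ℤ_[p])) (by
    simp only [map_sub, map_pow, aeval_X, one_pow, aeval_C, derivative_X_pow,
      derivative_C, map_mul, sub_zero]
    rw [mul_one, Algebra.algebraMap_self, RingHom.id_apply, RingHom.id_apply, hm', one_pow,
      sub_add_cancel_left, norm_neg, norm_mul, PadicInt.norm_p]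
    have h1 : ((p : ℝ))⁻¹ < 1 := inv_lt_one_of_one_lt₀ (by exact_mod_cast hp.out.one_lt)
    have h2 := PadicInt.norm_le_one x
    have h3 : 0 < ((p : ℝ))⁻¹ := inv_pos.2 (by exact_mod_cast hp.out.pos)
    nlinarith [norm_nonneg x])
  obtain ⟨z, hz, -⟩ := this
  refine ⟨z, ?_⟩
  simpa [sub_eq_zero] using hz

variable {L : Type*} [Field L] {w : L → ℤ}

open Classical in
/-- The normalised absolute value attached to a valuation extending the `p`-adic one. -/
noncomputable def absVal (h : IsIntVal w) (hpw : 0 < w (p : L)) : AbsoluteValue L ℝ where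
  toFun x := if x = 0 then 0 else (p : ℝ) ^ (-(w x : ℝ) / w (p : L))
  map_mul' x y := by
    by_cases hx : x = 0
    · simp [hx]
    by_cases hy : y = 0
    · simp [hy]
    have : (0 : ℝ) < p := by exact_mod_cast hp.out.pos
    simp only [hx, hy, mul_eq_zero, or_self, if_false]
    rw [← Real.rpow_add this, h.mul x y hx hy]
    congr 1; push_cast; ring
  nonneg' x := by split_ifs <;> positivity
  eq_zero' x := by
    have : (0 : ℝ) < p := by exact_mod_cast hp.out.pos
    simp [(Real.rpow_pos_of_pos this _).ne']
  add_le' x y := by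
    have hp1 : (1 : ℝ) < p := by exact_mod_cast hp.out.one_lt
    by_cases hx : x = 0
    · simp [hx]
    by_cases hy : y = 0
    · simp [hy]
    by_cases hxy : x + y = 0
    · simp only [hxy, if_true]; positivity
    simp only [hx, hy, hxy, if_false]
    have hpw' : (0 : ℝ) < w (p : L) := by exact_mod_cast hpw
    rcases min_le_iff.1 (h.add x y hx hy hxy) with h1 | h1
    · refine le_add_of_le_of_nonneg ?_ (by positivity)
      gcongr
      · exact hp1.le
    · refine le_add_of_nonneg_of_le (by positivity) ?_
      gcongr
      · exact hp1.le

theorem absVal_apply (h : IsIntVal w) (hpw : 0 < w (p : L)) {x : L} (hx : x ≠ 0) :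
    h.absVal hpw x = (p : ℝ) ^ (-(w x : ℝ) / w (p : L)) := by
  simp [absVal, hx]

theorem absVal_le_one_iff (h : IsIntVal w) (hpw : 0 < w (p : L)) (x : L) :
    h.absVal hpw x ≤ 1 ↔ x ∈ h.fil 0 := by
  have hp1 : (1 : ℝ) < p := by exact_mod_cast hp.out.one_lt
  have hpw' : (0 : ℝ) < w (p : L) := by exact_mod_cast hpw
  by_cases hx : x = 0
  · simp [hx]
  rw [h.absVal_apply hpw hx, h.mem_fil_of_ne_zero hx]
  constructor
  · intro h1
    by_contra hc
    have : (0 : ℝ) < -(w x : ℝ) := by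
      have : (w x : ℝ) < 0 := by exact_mod_cast not_le.1 hc
      linarith
    exact absurd h1 (not_le.2 (Real.one_lt_rpow hp1 (by positivity)))
  · intro h1
    refine Real.rpow_le_one_of_one_le_of_nonpos hp1.le ?_
    have : (0 : ℝ) ≤ (w x : ℝ) := by exact_mod_cast h1
    exact div_nonpos_of_nonpos_of_nonneg (by linarith) hpw'.le

variable [Algebra ℚ_[p] L]

theorem padicInt_mem (h : IsIntVal w) (hpw : 0 < w (p : L)) (x : ℤ_[p]) :
    algebraMap ℚ_[p] L x ∈ h.fil 0 := by
  by_contra hc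
  have hx0 : algebraMap ℚ_[p] L x ≠ 0 := fun h0 => hc (Or.inl h0)
  rw [h.mem_fil_of_ne_zero hx0, not_le] at hc
  set y := algebraMap ℚ_[p] L x with hy
  have hp0 : (p : L) ≠ 0 := fun h0 => by
    have : algebraMap ℚ_[p] L (p : ℚ_[p]) = 0 := by simpa using h0
    rw [map_eq_zero] at this
    exact hp.out.ne_zero (by exact_mod_cast this)
  obtain ⟨m, hm, hmp⟩ : ∃ m : ℕ, w (p : L) < m ∧ ¬ p ∣ m := by
    refine ⟨p * (w (p : L)).toNat + 1, ?_, ?_⟩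
    · have := hp.out.one_lt
      have h2 : ((w (p : L)).toNat : ℤ) = w (p : L) := Int.toNat_of_nonneg hpw.le
      have : (w (p : L)).toNat < p * (w (p : L)).toNat + 1 := by nlinarith
      omega
    · intro hd
      have := (Nat.dvd_add_right (dvd_mul_right p _)).1 hd
      exact hp.out.one_lt.ne' (Nat.dvd_one.1 this)
  obtain ⟨z, hz⟩ := exists_root m hmp (x ^ m)
  have hz' : (algebraMap ℚ_[p] L z) ^ m = p * y ^ m + 1 := by
    rw [hy, ← map_pow, ← map_pow, ← PadicInt.coe_pow, hz]
    push_cast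
    simp [add_comm]
  have hwy : w (p * y ^ m) = w (p : L) + m * w y := by
    rw [h.mul _ _ hp0 (pow_ne_zero _ hx0), h.pow hx0]
  have hneg : w (p * y ^ m) < 0 := by rw [hwy]; nlinarith
  obtain ⟨h1, h2⟩ := h.add_eq_left (x := p * y ^ m) (y := 1)
    (mul_ne_zero hp0 (pow_ne_zero _ hx0)) (Or.inr (by rw [h.one]; omega))
  rw [← hz'] at h1 h2
  have hz0 : algebraMap ℚ_[p] L z ≠ 0 := fun h0 => h1 (by
    rw [h0, zero_pow]; omega)
  rw [h.pow hz0, hwy] at h2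
  have : (m : ℤ) ∣ w (p : L) := ⟨w (algebraMap ℚ_[p] L z) - w y, by linarith⟩
  have := Int.le_of_dvd hpw this
  omega

theorem padic_eq (h : IsIntVal w) (hpw : 0 < w (p : L)) {x : ℚ_[p]} (hx : x ≠ 0) :
    w (algebraMap ℚ_[p] L x) = w (p : L) * x.valuation := by
  have hp0 : (p : ℚ_[p]) ≠ 0 := by exact_mod_cast hp.out.ne_zero
  have key : ∀ y : ℚ_[p], ‖y‖ = 1 → w (algebraMap ℚ_[p] L y) = 0 := by
    intro y hy
    have hy0 : y ≠ 0 := by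
      rintro rfl; simp at hy
    have h1 := h.padicInt_mem hpw ⟨y, hy.le⟩
    have h2 := h.padicInt_mem hpw ⟨y⁻¹, by simp [hy]⟩
    have hy1 : algebraMap ℚ_[p] L y ≠ 0 := by simpa using hy0
    rw [h.mem_fil_of_ne_zero (by simpa using hy0)] at h1 h2
    simp only [map_inv₀, h.inv hy1] at h2
    simp only at h1
    omega
  have hu : ‖x * (p : ℚ_[p]) ^ (-x.valuation)‖ = 1 := by
    rw [norm_mul, Padic.norm_eq_zpow_neg_valuation hx, norm_zpow, Padic.norm_p, inv_zpow, zpow_neg,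
      inv_inv, inv_mul_cancel₀]
    exact zpow_ne_zero _ (by exact_mod_cast hp.out.ne_zero)
  have := key _ hu
  rw [map_mul, h.mul _ _ ((map_ne_zero _).2 hx)
    ((map_ne_zero _).2 (zpow_ne_zero _ hp0)), map_zpow₀, h.zpow ((map_ne_zero _).2 hp0)] at this
  simp only [map_natCast] at this
  linarith

theorem absVal_eq_spectralNorm [FiniteDimensional ℚ_[p] L] (h : IsIntVal w)
    (hpw : 0 < w (p : L)) (x : L) : h.absVal hpw x = spectralNorm ℚ_[p] L x := by
  refine spectralNorm_unique_field_norm_ext (fun y => ?_) x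
  by_cases hy : y = 0
  · simp [hy]
  rw [h.absVal_apply hpw (by simpa using hy), h.padic_eq hpw hy, Padic.norm_eq_zpow_neg_valuation hy,
    ← Real.rpow_intCast]
  have : (w (p : L) : ℝ) ≠ 0 := by exact_mod_cast hpw.ne'
  congr 1
  push_cast
  field_simp

/-- Automorphisms over `ℚ_p` preserve the valuation. -/
theorem algEquiv_eq [FiniteDimensional ℚ_[p] L] (h : IsIntVal w)
    (hpw : 0 < w (p : L)) (σ : L ≃ₐ[ℚ_[p]] L) (x : L) : w (σ x) = w x := by
  by_cases hx : x = 0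
  · simp [hx]
  have h1 : h.absVal hpw x = h.absVal hpw (σ x) := by
    rw [absVal_eq_spectralNorm, absVal_eq_spectralNorm, ← spectralNorm_eq_of_equiv]
  have hp1 : (1 : ℝ) < p := by exact_mod_cast hp.out.one_lt
  have hpw' : (w (p : L) : ℝ) ≠ 0 := by exact_mod_cast hpw.ne'
  rw [h.absVal_apply hpw hx, h.absVal_apply hpw (by simpa using hx)] at h1
  have h2 := (Real.rpow_right_inj (by linarith) hp1.ne').1 h1
  have h3 : (w x : ℝ) = w (σ x) := by field_simp at h2; linarith
  exact_mod_cast h3.symm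

end Padic

end IsIntVal

namespace IsIntVal
section Residue

variable {p : ℕ} [hp : Fact p.Prime]
variable {L : Type*} [Field L] {w : L → ℤ}

theorem fil_eq_map (h : IsIntVal w) {x : L} (hx : x ≠ 0) (j : ℤ) :
    h.fil (j + w x) = (h.fil j).map (AddMonoidHom.mulRight x) := by
  ext y
  constructor
  · intro hy
    refine ⟨y * x⁻¹, ?_, by simp [hx]⟩
    simpa using h.mul_mem hy (y := x⁻¹) (j := -w x) (Or.inr (h.inv hx).ge)
  · rintro ⟨y, hy, rfl⟩
    exact h.mul_mem hy (Or.inr le_rfl)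

theorem relIndex_fil_shift (h : IsIntVal w) {x : L} (hx : x ≠ 0) (i j : ℤ) :
    (h.fil (i + w x)).relIndex (h.fil (j + w x)) = (h.fil i).relIndex (h.fil j) := by
  rw [h.fil_eq_map hx, h.fil_eq_map hx, AddSubgroup.relIndex_map_map_of_injective]
  intro a b hab
  simpa [hx] using hab

theorem relIndex_fil_pow (h : IsIntVal w) {x : L} (hx : x ≠ 0) (hwx : 0 ≤ w x) (n : ℕ) :
    (h.fil (n * w x)).relIndex (h.fil 0) = (h.fil (w x)).relIndex (h.fil 0) ^ n := by
  induction n with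
  | zero => simp
  | succ n ih =>
    have h1 := h.relIndex_fil_shift (pow_ne_zero n hx) (w x) 0
    rw [h.pow hx, zero_add] at h1
    have h2 : ((n + 1 : ℕ) : ℤ) * w x = w x + n * w x := by push_cast; ring
    rw [pow_succ, ← ih, h2, ← h1, mul_comm (AddSubgroup.relIndex _ _), AddSubgroup.relIndex_mul_relIndex]
    · exact h.fil_anti (by omega)
    · exact h.fil_anti (by positivity)

/-- The valuation ring. -/
def integer (h : IsIntVal w) : Subring L where
  __ := h.fil 0
  one_mem' := h.one_mem
  mul_mem' := fun hx hy => h.mul_mem' hx hy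

theorem exists_add_pow_eq (h : IsIntVal w) {x y : L} (hx : x ∈ h.fil 0) (hy : y ∈ h.fil 0) :
    ∃ r ∈ h.fil 0, (x + y) ^ p = x ^ p + y ^ p + p * x * y * r := by
  let x' : h.integer := ⟨x, hx⟩
  let y' : h.integer := ⟨y, hy⟩
  have := add_pow_prime_eq hp.out x' y'
  exact ⟨_, Subtype.property _, congrArg Subtype.val this⟩

theorem mem_fil_one_of_pow (h : IsIntVal w) {x : L} {n : ℕ} (hn : n ≠ 0)
    (hx : x ^ n ∈ h.fil 1) : x ∈ h.fil 1 := by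
  by_cases hx0 : x = 0
  · exact Or.inl hx0
  rw [h.mem_fil_of_ne_zero (pow_ne_zero _ hx0), h.pow hx0] at hx
  rw [h.mem_fil_of_ne_zero hx0]
  by_contra hc
  have : (0 : ℤ) ≤ n := by positivity
  nlinarith

theorem sub_pow_sub_mem (h : IsIntVal w) (hpw : 0 < w (p : L)) (hodd : Odd p) {x y : L}
    (hx : x ∈ h.fil 0) (hy : y ∈ h.fil 0) : (x - y) ^ p - (x ^ p - y ^ p) ∈ h.fil 1 := by
  obtain ⟨r, hr, he⟩ := h.exists_add_pow_eq (p := p) hx (neg_mem hy)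
  have : (x - y) ^ p - (x ^ p - y ^ p) = p * (x * -y * r) := by
    rw [sub_eq_add_neg x y, he, hodd.neg_pow]; ring
  rw [this, mul_comm]
  exact h.mul_mem' (h.mul_mem' (h.mul_mem' hx (neg_mem hy)) hr) (Or.inr hpw)

theorem sub_mem_of_pow_sub_mem (h : IsIntVal w) (hpw : 0 < w (p : L)) (hodd : Odd p) {x y : L}
    (hx : x ∈ h.fil 0) (hy : y ∈ h.fil 0) (hxy : x ^ p - y ^ p ∈ h.fil 1) : x - y ∈ h.fil 1 := by
  refine h.mem_fil_one_of_pow hp.out.ne_zero ?_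
  simpa using add_mem (h.sub_pow_sub_mem hpw hodd hx hy) hxy

theorem sub_mem_of_pow_pow_sub_mem (h : IsIntVal w) (hpw : 0 < w (p : L)) (hodd : Odd p)
    {x y : L} (hx : x ∈ h.fil 0) (hy : y ∈ h.fil 0) (n : ℕ)
    (hxy : x ^ p ^ n - y ^ p ^ n ∈ h.fil 1) : x - y ∈ h.fil 1 := by
  induction n with
  | zero => simpa using hxy
  | succ n ih =>
    rw [pow_succ, pow_mul, pow_mul] at hxy
    exact ih (h.sub_mem_of_pow_sub_mem hpw hodd (h.pow_mem_zero hx _) (h.pow_mem_zero hy _) hxy)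

variable [Algebra ℚ_[p] L]

theorem isIntegral_iff [FiniteDimensional ℚ_[p] L] [Algebra ℤ_[p] L]
    [IsScalarTower ℤ_[p] ℚ_[p] L] (h : IsIntVal w) (hpw : 0 < w (p : L)) (x : L) :
    IsIntegral ℤ_[p] x ↔ x ∈ h.fil 0 := by
  constructor
  · rintro ⟨P, hP, hPx⟩
    by_contra hc
    have hx0 : x ≠ 0 := fun h0 => hc (Or.inl h0)
    rw [h.mem_fil_of_ne_zero hx0, not_le] at hc
    have hlead : P.coeff P.natDegree = 1 := hP
    rw [Polynomial.eval₂_eq_sum_range, Finset.sum_range_succ, hlead, map_one, one_mul,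
      add_comm] at hPx
    refine (h.add_eq_left (pow_ne_zero P.natDegree hx0) (sum_mem fun i hi => ?_)).1 hPx
    have hi' : i < P.natDegree := Finset.mem_range.1 hi
    refine h.mul_mem' ?_ (Or.inr ?_)
    · rw [IsScalarTower.algebraMap_apply ℤ_[p] ℚ_[p] L]
      exact h.padicInt_mem hpw _
    · rw [h.pow hx0, h.pow hx0]
      have : (i : ℤ) + 1 ≤ P.natDegree := by exact_mod_cast hi'
      nlinarith
  · intro hx
    rw [← h.absVal_le_one_iff hpw, h.absVal_eq_spectralNorm hpw, spectralNorm,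
      spectralValue_le_one_iff (minpoly.monic (Algebra.IsIntegral.isIntegral x))] at hx
    have hl : minpoly ℚ_[p] x ∈ Polynomial.lifts (algebraMap ℤ_[p] ℚ_[p]) := by
      rw [Polynomial.lifts_iff_coeff_lifts]
      exact fun n => ⟨⟨_, hx n⟩, rfl⟩
    obtain ⟨Q, hQ, -, hQm⟩ := Polynomial.lifts_and_natDegree_eq_and_monic hl
      (minpoly.monic (Algebra.IsIntegral.isIntegral x))
    refine ⟨Q, hQm, ?_⟩
    have := minpoly.aeval ℚ_[p] x
    rw [← hQ, Polynomial.aeval_map_algebraMap] at this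
    exact this

/-- The integers modulo `p` have order `p` to the degree over `ℚ_p`. -/
theorem relIndex_fil_prime [FiniteDimensional ℚ_[p] L] (h : IsIntVal w) (hpw : 0 < w (p : L)) :
    (h.fil (w (p : L))).relIndex (h.fil 0) = p ^ Module.finrank ℚ_[p] L := by
  let _ : Algebra ℤ_[p] L := ((algebraMap ℚ_[p] L).comp (algebraMap ℤ_[p] ℚ_[p])).toAlgebra
  have : IsScalarTower ℤ_[p] ℚ_[p] L := IsScalarTower.of_algebraMap_eq fun _ => rfl
  have hp0 : (p : L) ≠ 0 := by
    have : ((p : ℚ_[p])) ≠ 0 := by exact_mod_cast hp.out.ne_zero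
    rw [← map_natCast (algebraMap ℚ_[p] L)]
    exact (map_ne_zero _).2 this
  have : CharZero L := charZero_of_injective_algebraMap (algebraMap ℚ_[p] L).injective
  have : Module.IsTorsionFree ℤ_[p] L := .trans_faithfulSMul ℤ_[p] ℚ_[p] L
  let C := integralClosure ℤ_[p] L
  have : Module.Free ℤ_[p] C := IsIntegralClosure.module_free ℤ_[p] ℚ_[p] L C
  have : Module.Finite ℤ_[p] C := IsIntegralClosure.finite ℤ_[p] ℚ_[p] L C
  let b := Module.finBasisOfFinrankEq ℤ_[p] C (IsIntegralClosure.rank ℤ_[p] ℚ_[p] L C)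
  have hC : ∀ x : L, x ∈ C ↔ x ∈ h.fil 0 := fun x => h.isIntegral_iff hpw x
  let φ : h.fil 0 →+ (Fin (Module.finrank ℚ_[p] L) → ZMod p) :=
    { toFun := fun x i => PadicInt.toZMod (b.repr ⟨x.1, (hC _).2 x.2⟩ i)
      map_zero' := by
        funext i
        have : (⟨0, (hC _).2 (zero_mem _)⟩ : C) = 0 := rfl
        change PadicInt.toZMod (b.repr ⟨0, (hC _).2 (zero_mem _)⟩ i) = 0
        rw [this, map_zero, Finsupp.zero_apply, map_zero]
      map_add' := fun x y => by
        funext i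
        have : (⟨x.1 + y.1, (hC _).2 (add_mem x.2 y.2)⟩ : C) =
          ⟨x.1, (hC _).2 x.2⟩ + ⟨y.1, (hC _).2 y.2⟩ := rfl
        change PadicInt.toZMod (b.repr ⟨x.1 + y.1, (hC _).2 (add_mem x.2 y.2)⟩ i) = _
        rw [this, map_add, Finsupp.add_apply, map_add]
        rfl }
  have hsurj : Function.Surjective φ := by
    intro v
    choose g hg using fun i => ZMod.ringHom_surjective (PadicInt.toZMod (p := p)) (v i)
    let c : C := b.equivFun.symm g
    refine ⟨⟨c.1, (hC _).1 c.2⟩, ?_⟩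
    funext i
    have : b.repr c i = g i := by
      rw [← b.equivFun_apply, LinearEquiv.apply_symm_apply]
    exact (congrArg PadicInt.toZMod this).trans (hg i)
  have hker : φ.ker = (h.fil (w (p : L))).addSubgroupOf (h.fil 0) := by
    ext x
    rw [AddMonoidHom.mem_ker, AddSubgroup.mem_addSubgroupOf]
    constructor
    · intro hx
      have h1 : ∀ i, ∃ y : ℤ_[p], b.repr ⟨x.1, (hC _).2 x.2⟩ i = p * y := by
        intro i
        have : PadicInt.toZMod (b.repr ⟨x.1, (hC _).2 x.2⟩ i) = 0 := congrFun hx i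
        rw [← RingHom.mem_ker, PadicInt.ker_toZMod, PadicInt.maximalIdeal_eq_span_p,
          Ideal.mem_span_singleton] at this
        exact this
      choose y hy using h1
      let c : C := b.equivFun.symm y
      have h2 : (⟨x.1, (hC _).2 x.2⟩ : C) = (p : ℤ_[p]) • c := by
        apply b.equivFun.injective
        rw [map_smul, LinearEquiv.apply_symm_apply]
        funext i
        exact hy i
      have h3 : x.1 = p * c.1 := by
        have := congrArg Subtype.val h2
        simpa [Algebra.smul_def] using this
      rw [h3]
      simpa using h.mul_mem (i := w (p : L)) (j := 0) (Or.inr le_rfl) ((hC _).1 c.2)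
    · intro hx
      have hy : (p : L)⁻¹ * x.1 ∈ h.fil 0 := by
        simpa using h.mul_mem (i := - w (p : L)) (Or.inr (h.inv hp0).ge) hx
      have h2 : (⟨x.1, (hC _).2 x.2⟩ : C) = (p : ℤ_[p]) • ⟨_, (hC _).2 hy⟩ := by
        apply Subtype.ext
        simp [Algebra.smul_def, hp0]
      funext i
      change PadicInt.toZMod (b.repr ⟨x.1, (hC _).2 x.2⟩ i) = 0
      rw [h2, map_smul]
      simp
  rw [AddSubgroup.relIndex, ← hker, AddSubgroup.index_ker, AddMonoidHom.range_eq_top.2 hsurj,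
    AddSubgroup.card_top]
  simp

/-- Existence of `p`-th roots modulo the maximal ideal. -/
theorem exists_pow_sub_mem [FiniteDimensional ℚ_[p] L] (h : IsIntVal w) (hpw : 0 < w (p : L))
    (hodd : Odd p) {x : L} (hx : x ∈ h.fil 0) : ∃ y ∈ h.fil 0, x - y ^ p ∈ h.fil 1 := by
  have hfin : (h.fil 1).relIndex (h.fil 0) ≠ 0 := by
    refine fun h0 => pow_ne_zero (Module.finrank ℚ_[p] L) hp.out.ne_zero ?_
    rw [← h.relIndex_fil_prime hpw]
    exact AddSubgroup.relIndex_eq_zero_of_le_left (h.fil_anti (by omega)) h0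
  have : Finite (h.fil 0 ⧸ (h.fil 1).addSubgroupOf (h.fil 0)) :=
    Nat.finite_of_card_ne_zero hfin
  let g : ℕ → h.fil 0 ⧸ (h.fil 1).addSubgroupOf (h.fil 0) :=
    fun n => QuotientAddGroup.mk ⟨x ^ p ^ n, h.pow_mem_zero hx _⟩
  obtain ⟨a, b, hab, hne⟩ : ∃ a b, g a = g b ∧ a < b := by
    obtain ⟨a, b, hab, hne⟩ := Finite.exists_ne_map_eq_of_infinite g
    rcases lt_or_gt_of_ne hab with hlt | hlt
    · exact ⟨a, b, hne, hlt⟩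
    · exact ⟨b, a, hne.symm, hlt⟩
  have h1 : -(x ^ p ^ a) + x ^ p ^ b ∈ h.fil 1 := by
    simpa [AddSubgroup.mem_addSubgroupOf] using QuotientAddGroup.eq.1 hab
  obtain ⟨k, rfl⟩ := Nat.exists_eq_add_of_lt hne
  refine ⟨x ^ p ^ k, h.pow_mem_zero hx _, ?_⟩
  refine h.sub_mem_of_pow_pow_sub_mem hpw hodd hx (h.pow_mem_zero (h.pow_mem_zero hx _) _) a ?_
  have h2 := neg_mem h1
  rw [neg_add, neg_neg, ← sub_eq_add_neg] at h2
  convert h2 using 2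
  rw [← pow_mul, ← pow_mul]
  congr 1
  ring

end Residue
end IsIntVal

namespace IsIntVal
section PthPowers

variable {K : Type*} [Field K] {w : K → ℤ}

theorem mul_sub_one_sub_mem (h : IsIntVal w) {j : ℤ} (hj : 1 ≤ j) {x y a b : K}
    (ha : a ∈ h.fil j) (hb : b ∈ h.fil j) (hx : x - 1 - a ∈ h.fil (j + 1))
    (hy : y - 1 - b ∈ h.fil (j + 1)) : x * y - 1 - (a + b) ∈ h.fil (j + 1) := by
  have hx' : x - 1 ∈ h.fil j := by
    simpa using add_mem (h.fil_anti (by omega) hx) ha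
  have hy' : y - 1 ∈ h.fil j := by
    simpa using add_mem (h.fil_anti (by omega) hy) hb
  have : x * y - 1 - (a + b) = (x - 1 - a) + (y - 1 - b) + (x - 1) * (y - 1) := by ring
  rw [this]
  exact add_mem (add_mem hx hy) (h.fil_anti (by omega) (h.mul_mem hx' hy'))

theorem pow_sub_one_sub_mem (h : IsIntVal w) {j : ℤ} (hj : 1 ≤ j) {x a : K}
    (ha : a ∈ h.fil j) (hx : x - 1 - a ∈ h.fil (j + 1)) (n : ℕ) :
    x ^ n - 1 - n * a ∈ h.fil (j + 1) := by
  induction n with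
  | zero => simp
  | succ n ih =>
    rw [pow_succ, Nat.cast_succ, add_mul, one_mul]
    exact h.mul_sub_one_sub_mem hj (h.mul_mem' (h.natCast_mem n) ha) ha ih hx

theorem prod_sub_one_sub_mem (h : IsIntVal w) {j : ℤ} (hj : 1 ≤ j) {ι : Type*} (s : Finset ι)
    (x a : ι → K) (ha : ∀ i ∈ s, a i ∈ h.fil j) (hx : ∀ i ∈ s, x i - 1 - a i ∈ h.fil (j + 1)) :
    ∏ i ∈ s, x i - 1 - ∑ i ∈ s, a i ∈ h.fil (j + 1) := by
  classical
  induction s using Finset.induction_on with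
  | empty => simp
  | insert i s hi ih =>
    rw [Finset.prod_insert hi, Finset.sum_insert hi]
    rw [Finset.forall_mem_insert] at ha hx
    exact h.mul_sub_one_sub_mem hj ha.1 (sum_mem ha.2) hx.1 (ih ha.2 hx.2)

/-- The group `U_j` of units congruent to `1` modulo the `j`-th power of the maximal ideal. -/
def unitFil (h : IsIntVal w) {j : ℤ} (hj : 1 ≤ j) : Subgroup Kˣ where
  carrier := {x | (x : K) - 1 ∈ h.fil j}
  one_mem' := by simp
  mul_mem' {x y} hx hy := by
    have : ((x * y : Kˣ) : K) - 1 = (x - 1 : K) + (y - 1) + (x - 1) * (y - 1) := by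
      push_cast; ring
    change ((x * y : Kˣ) : K) - 1 ∈ h.fil j
    rw [this]
    exact add_mem (add_mem hx hy) (h.fil_anti (by omega) (h.mul_mem hx hy))
  inv_mem' {x} hx := by
    have h1 := h.unit_of_sub_one_mem hj hx
    have : ((x⁻¹ : Kˣ) : K) - 1 = (x : K)⁻¹ * -(x - 1) := by
      rw [Units.val_inv_eq_inv_val]
      field_simp
      ring
    change ((x⁻¹ : Kˣ) : K) - 1 ∈ h.fil j
    rw [this]
    exact h.mul_mem' (Or.inr (by rw [h.inv h1.1, h1.2, neg_zero])) (neg_mem hx)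

theorem mem_unitFil (h : IsIntVal w) {j : ℤ} (hj : 1 ≤ j) {x : Kˣ} :
    x ∈ h.unitFil hj ↔ (x : K) - 1 ∈ h.fil j := Iff.rfl

variable {p : ℕ} [hp : Fact p.Prime]

/-- For `k` below the critical bound, the leading term of the `p`-th power of an element `1 + z`
with `z` of valuation at least `k` is `z ^ p`. -/
theorem pow_prime_sub_mem (h : IsIntVal w) {R k : ℤ} (hR : (p - 1) * R = w (p : K)) (hk : 1 ≤ k)
    (hkR : k < R) {z : K} (hz : z ∈ h.fil k) :
    (1 + z) ^ p - 1 - z ^ p ∈ h.fil (p * k + 1) := by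
  obtain ⟨r, hr, he⟩ := h.exists_add_pow_eq (p := p) h.one_mem (h.fil_anti (by omega) hz)
  have : (1 + z) ^ p - 1 - z ^ p = p * z * r := by rw [he, one_pow]; ring
  rw [this, mul_comm _ r]
  refine h.mul_mem' hr (h.fil_anti ?_ (h.mul_mem (i := w (p : K)) (Or.inr le_rfl) hz))
  have : (2 : ℤ) ≤ p := by exact_mod_cast hp.out.two_le
  rw [← hR]
  nlinarith

/-- The valuation of `y ^ p - 1`, if small and positive, is divisible by `p`. -/
theorem dvd_of_pow_sub_one (h : IsIntVal w) (hodd : Odd p) {R j : ℤ}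
    (hR : (p - 1) * R = w (p : K)) (hpw : 0 < w (p : K)) (hj : 1 ≤ j) (hjR : j < p * R) {y : K}
    (h1 : y ^ p - 1 ∈ h.fil j) (h2 : y ^ p - 1 ∉ h.fil (j + 1)) : (p : ℤ) ∣ j := by
  have hp2 : (2 : ℤ) ≤ p := by exact_mod_cast hp.out.two_le
  obtain ⟨hy0, hwy⟩ := h.unit_of_sub_one_mem hj h1
  have hy0' : y ≠ 0 := fun h0 => hy0 (by rw [h0, zero_pow hp.out.ne_zero])
  have hy : y ∈ h.fil 0 := by
    rw [h.pow hy0'] at hwy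
    rw [h.mem_fil_of_ne_zero hy0']
    rcases mul_eq_zero.1 hwy with h3 | h3 <;> omega
  have hz : y - 1 ∈ h.fil 1 :=
    h.sub_mem_of_pow_sub_mem hpw hodd hy h.one_mem (by simpa using h.fil_anti hj h1)
  have hz0 : y - 1 ≠ 0 := fun h0 => h2 (by rw [sub_eq_zero.1 h0]; simp)
  set z := y - 1 with hzdef
  have hyz : y = 1 + z := by rw [hzdef]; ring
  rw [h.mem_fil_of_ne_zero hz0] at hz
  rcases lt_or_ge (w z) R with hlt | hge
  · have h3 := h.pow_prime_sub_mem hR hz hlt (Or.inr le_rfl)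
    have h4 := h.add_eq_left (pow_ne_zero p hz0) (y := (1 + z) ^ p - 1 - z ^ p)
      (by rwa [h.pow hz0])
    rw [add_sub_cancel, ← hyz] at h4
    rw [h.mem_fil_of_ne_zero h4.1, h4.2, h.pow hz0] at h1 h2
    exact ⟨w z, by omega⟩
  · exfalso
    apply h2
    obtain ⟨r, hr, he⟩ := h.exists_add_pow_eq (p := p) h.one_mem (x := 1) (y := z)
      (Or.inr (by omega))
    have : y ^ p - 1 = z ^ p + r * (p * z) := by rw [hyz, he, one_pow]; ring
    rw [this]
    refine add_mem (Or.inr ?_) (h.mul_mem' hr (h.fil_anti ?_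
      (h.mul_mem (i := w (p : K)) (j := w z) (Or.inr le_rfl) (Or.inr le_rfl))))
    · rw [h.pow hz0]; nlinarith
    · rw [← hR]; nlinarith

variable [Algebra ℚ_[p] K] [FiniteDimensional ℚ_[p] K]

/-- Modulo `p`-th powers, units of level `p * k` below the critical bound can be improved. -/
theorem exists_eq_mul_pow (h : IsIntVal w) (hodd : Odd p) {R k : ℤ} {π : K} (hπ0 : π ≠ 0)
    (hπ : w π = 1) (hR : (p - 1) * R = w (p : K)) (hpw : 0 < w (p : K)) (hk : 1 ≤ k) (hkR : k < R)
    {u : K} (hu : u - 1 ∈ h.fil (p * k)) :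
    ∃ u' y : K, y ≠ 0 ∧ u' - 1 ∈ h.fil (p * k + 1) ∧ u = u' * y ^ p := by
  have hwk : w (π ^ k) = k := by rw [h.zpow hπ0, hπ, mul_one]
  have hk0 : π ^ k ≠ 0 := zpow_ne_zero _ hπ0
  have hx : (u - 1) * ((π ^ k) ^ p)⁻¹ ∈ h.fil 0 := by
    have := h.mul_mem hu (y := ((π ^ k) ^ p)⁻¹) (j := -(p * k)) (Or.inr (by
      rw [h.inv (pow_ne_zero _ hk0), h.pow hk0, hwk]))
    simpa using this
  obtain ⟨z, hz, hxz⟩ := h.exists_pow_sub_mem hpw hodd hx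
  have hzk : π ^ k * z ∈ h.fil k := by
    simpa using h.mul_mem (i := k) (Or.inr hwk.ge) hz
  have h1 := h.pow_prime_sub_mem hR hk hkR hzk
  obtain ⟨hy0, hwy⟩ := h.unit_of_sub_one_mem hk (x := 1 + π ^ k * z) (by simpa using hzk)
  set y := 1 + π ^ k * z with hy
  have h2 : u - y ^ p ∈ h.fil (p * k + 1) := by
    have h3 := h.mul_mem (i := p * k) (x := (π ^ k) ^ p) (Or.inr (by rw [h.pow hk0, hwk])) hxz
    have h4 := sub_mem h3 h1
    convert h4 using 1
    rw [mul_sub, mul_pow]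
    field_simp
    ring
  refine ⟨u * (y ^ p)⁻¹, y, hy0, ?_, by field_simp⟩
  have h5 : u * (y ^ p)⁻¹ - 1 = (y ^ p)⁻¹ * (u - y ^ p) := by field_simp
  rw [h5]
  exact h.mul_mem' (Or.inr (by
    rw [h.inv (pow_ne_zero _ hy0), h.pow hy0, hwy, mul_zero, neg_zero])) h2

end PthPowers
end IsIntVal

section Classes

variable {p : ℕ} {K : Type*} [Field K]

theorem KmodP.mk_eq_iff {a b : Kˣ} :
    (QuotientGroup.mk a : KmodP p K) = QuotientGroup.mk b ↔
      ∃ y : K, y ≠ 0 ∧ (a : K) = b * y ^ p := by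
  rw [eq_comm, QuotientGroup.eq]
  constructor
  · rintro ⟨z, hz⟩
    refine ⟨z, z.ne_zero, ?_⟩
    have : a = b * z ^ p := by
      rw [← powMonoidHom_apply, hz]; group
    rw [this]; simp
  · rintro ⟨y, hy, h⟩
    refine ⟨Units.mk0 y hy, ?_⟩
    have : a = b * (Units.mk0 y hy) ^ p := Units.ext (by simpa using h)
    rw [this]; simp

theorem KmodP.pow_prime (q : KmodP p K) : q ^ p = 1 := by
  induction q using QuotientGroup.induction_on with
  | H a => exact (QuotientGroup.eq_one_iff _).2 ⟨a, rfl⟩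

theorem KmodP.pow_eq_pow (q : KmodP p K) {a b : ℕ} (hab : (a : ZMod p) = b) : q ^ a = q ^ b := by
  rw [pow_eq_pow_mod a (KmodP.pow_prime q), pow_eq_pow_mod b (KmodP.pow_prime q),
    (ZMod.natCast_eq_natCast_iff' a b p).1 hab]

end Classes

section EigenProj

variable {p : ℕ} {F K : Type*} [Field F] [Field K] [Algebra F K]

/-- The exponent of `σ` in the projector onto the `ω`-eigenspace. -/
noncomputable def eigenCoeff (ω : (K ≃ₐ[F] K) → (ZMod p)ˣ) (σ : K ≃ₐ[F] K) : ℕ :=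
  ((Nat.card (K ≃ₐ[F] K) : ZMod p)⁻¹ * ((ω σ)⁻¹ : (ZMod p)ˣ)).val

variable (ω : (K ≃ₐ[F] K) → (ZMod p)ˣ)

theorem mk_map_eq_iff {x : Kˣ} {σ : K ≃ₐ[F] K} :
    (QuotientGroup.mk (Units.map (σ : K →* K) x) : KmodP p K)
        = (QuotientGroup.mk x) ^ (ω σ : ZMod p).val ↔
      ∃ y : K, y ≠ 0 ∧ σ (x : K) = (x : K) ^ (ω σ : ZMod p).val * y ^ p := by
  rw [← QuotientGroup.mk_pow, KmodP.mk_eq_iff]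
  simp

theorem natCast_eigenCoeff [hp : Fact p.Prime] (σ : K ≃ₐ[F] K) :
    (eigenCoeff ω σ : ZMod p) =
      (Nat.card (K ≃ₐ[F] K) : ZMod p)⁻¹ * ((ω σ)⁻¹ : (ZMod p)ˣ) := by
  rw [eigenCoeff, ZMod.natCast_zmod_val]

variable [Fintype (K ≃ₐ[F] K)]

/-- A lift to `Kˣ` of the projector onto the `ω`-eigenspace of `Kˣ/(Kˣ)ᵖ`. -/
noncomputable def eigenProj : Kˣ →* Kˣ :=
  ∏ σ : K ≃ₐ[F] K, (powMonoidHom (eigenCoeff ω σ)).comp (Units.map (σ : K →* K))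

/-- The induced map from `Kˣ` to `Kˣ/(Kˣ)ᵖ`. -/
noncomputable def eigenClass : Kˣ →* KmodP p K :=
  (QuotientGroup.mk' (pthPowers p K)).comp (eigenProj ω)

theorem eigenProj_apply (x : Kˣ) :
    eigenProj ω x = ∏ σ : K ≃ₐ[F] K, Units.map (σ : K →* K) x ^ eigenCoeff ω σ := by
  simp [eigenProj, MonoidHom.finsetProd_apply]

theorem coe_eigenProj (x : Kˣ) :
    (eigenProj ω x : K) = ∏ σ : K ≃ₐ[F] K, σ (x : K) ^ eigenCoeff ω σ := by
  rw [eigenProj_apply, Units.coe_prod]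
  simp

theorem eigenClass_apply (x : Kˣ) :
    eigenClass ω x = ∏ σ : K ≃ₐ[F] K,
      (QuotientGroup.mk (Units.map (σ : K →* K) x) : KmodP p K) ^ eigenCoeff ω σ := by
  change (QuotientGroup.mk' (pthPowers p K)) (eigenProj ω x) = _
  rw [eigenProj_apply, map_prod]
  rfl

theorem eigenClass_pow_prime (x : Kˣ) : eigenClass ω (x ^ p) = 1 := by
  rw [map_pow, KmodP.pow_prime]

theorem eigenClass_eq_of_mk_eq {x x' : Kˣ}
    (h : (QuotientGroup.mk x : KmodP p K) = QuotientGroup.mk x') :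
    eigenClass ω x = eigenClass ω x' := by
  obtain ⟨y, hy, h⟩ := KmodP.mk_eq_iff.1 h
  have : x = x' * Units.mk0 y hy ^ p := Units.ext (by simpa using h)
  rw [this, map_mul, eigenClass_pow_prime]
  exact mul_one (eigenClass ω x')

variable [hp : Fact p.Prime]

/-- The projector is the identity on the eigenspace. -/
theorem eigenClass_eq_mk (hd : (Nat.card (K ≃ₐ[F] K) : ZMod p) ≠ 0) {x : Kˣ}
    (hx : ∀ σ : K ≃ₐ[F] K, ∃ y : K, y ≠ 0 ∧ σ (x : K) = (x : K) ^ (ω σ : ZMod p).val * y ^ p) :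
    eigenClass ω x = QuotientGroup.mk x := by
  rw [eigenClass_apply]
  simp_rw [fun σ => (mk_map_eq_iff ω).2 (hx σ), ← pow_mul]
  rw [Finset.prod_pow_eq_pow_sum]
  conv_rhs => rw [← pow_one (QuotientGroup.mk x : KmodP p K)]
  apply KmodP.pow_eq_pow
  push_cast
  have : ∀ σ : K ≃ₐ[F] K, ((ω σ : ZMod p).val : ZMod p) * (eigenCoeff ω σ : ZMod p) =
      (Nat.card (K ≃ₐ[F] K) : ZMod p)⁻¹ := by
    intro σ
    rw [natCast_eigenCoeff, ZMod.natCast_zmod_val, mul_left_comm, Units.mul_inv, mul_one]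
  rw [Finset.sum_congr rfl fun σ _ => this σ, Finset.sum_const, Finset.card_univ,
    ← Nat.card_eq_fintype_card, nsmul_eq_mul, mul_inv_cancel₀ hd]

/-- The projector takes values in the eigenspace. -/
theorem eigenProj_isEigen (hω : ∀ σ τ : K ≃ₐ[F] K, ω (σ * τ) = ω σ * ω τ) (x : Kˣ)
    (τ : K ≃ₐ[F] K) : ∃ y : K, y ≠ 0 ∧
      τ (eigenProj ω x : K) = (eigenProj ω x : K) ^ (ω τ : ZMod p).val * y ^ p := by
  rw [← mk_map_eq_iff]
  have h1 : (QuotientGroup.mk (eigenProj ω x) : KmodP p K) = eigenClass ω x := rfl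
  have h2 : Units.map (τ : K →* K) (eigenProj ω x) =
      ∏ σ : K ≃ₐ[F] K, Units.map ((τ * σ : K ≃ₐ[F] K) : K →* K) x ^ eigenCoeff ω σ := by
    rw [eigenProj_apply, map_prod]
    refine Finset.prod_congr rfl fun σ _ => ?_
    rw [map_pow]
    rfl
  have h3 : (QuotientGroup.mk (Units.map (τ : K →* K) (eigenProj ω x)) : KmodP p K) =
      ∏ σ : K ≃ₐ[F] K, (QuotientGroup.mk (Units.map ((τ * σ : K ≃ₐ[F] K) : K →* K) x) :
        KmodP p K) ^ eigenCoeff ω σ := by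
    rw [h2]
    exact map_prod (QuotientGroup.mk' (pthPowers p K)) _ _
  rw [h3, h1, eigenClass_apply, ← Finset.prod_pow,
    ← Equiv.prod_comp (Equiv.mulLeft τ) fun σ => ((QuotientGroup.mk (Units.map (σ : K →* K) x) :
      KmodP p K) ^ eigenCoeff ω σ) ^ (ω τ : ZMod p).val]
  refine Finset.prod_congr rfl fun σ _ => ?_
  rw [Equiv.coe_mulLeft, ← pow_mul]
  apply KmodP.pow_eq_pow
  push_cast
  rw [natCast_eigenCoeff, natCast_eigenCoeff, ZMod.natCast_zmod_val, hω, mul_inv, Units.val_mul,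
    mul_assoc, mul_assoc, mul_left_comm (((ω τ)⁻¹ : (ZMod p)ˣ) : ZMod p), Units.inv_mul, mul_one]

theorem eigenClass_eigenProj (hd : (Nat.card (K ≃ₐ[F] K) : ZMod p) ≠ 0)
    (hω : ∀ σ τ : K ≃ₐ[F] K, ω (σ * τ) = ω σ * ω τ) (x : Kˣ) :
    eigenClass ω (eigenProj ω x) = eigenClass ω x :=
  eigenClass_eq_mk ω hd (eigenProj_isEigen ω hω x)

end EigenProj

section Cyclotomic

variable {p : ℕ} [hp : Fact p.Prime] {F K : Type*} [Field F] [Field K] [Algebra F K] {ζ : K}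
  {ω : (K ≃ₐ[F] K) → (ZMod p)ˣ}

theorem IsPrimitiveRoot.natCast_eq_of_pow_eq (hζ : IsPrimitiveRoot ζ p) {a b : ℕ}
    (hab : ζ ^ a = ζ ^ b) : (a : ZMod p) = b := by
  rw [ZMod.natCast_eq_natCast_iff']
  apply hζ.pow_inj (Nat.mod_lt _ hp.out.pos) (Nat.mod_lt _ hp.out.pos)
  rw [← pow_eq_pow_mod a hζ.pow_eq_one, ← pow_eq_pow_mod b hζ.pow_eq_one, hab]

theorem cyclotomicChar_mul (hζ : IsPrimitiveRoot ζ p)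
    (hω : ∀ σ : K ≃ₐ[F] K, σ ζ = ζ ^ (ω σ : ZMod p).val) (σ τ : K ≃ₐ[F] K) :
    ω (σ * τ) = ω σ * ω τ := by
  have h1 : ζ ^ (ω (σ * τ) : ZMod p).val = ζ ^ ((ω σ : ZMod p).val * (ω τ : ZMod p).val) := by
    rw [← hω, AlgEquiv.mul_apply, hω τ, map_pow, hω σ, pow_mul]
  ext
  simpa using hζ.natCast_eq_of_pow_eq h1

theorem isCyclotomicExtension_of_adjoin_eq_top (hζ : IsPrimitiveRoot ζ p)
    (hK : IntermediateField.adjoin F {ζ} = ⊤) : IsCyclotomicExtension {p} F K := by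
  have hint : IsIntegral F ζ := (hζ.isIntegral hp.out.pos).tower_top
  have htop := Algebra.adjoin_eq_top_of_intermediateField (S := {ζ})
    (by simpa using hint.isAlgebraic) hK
  have hsub : ({ζ} : Set K) ⊆ {b : K | b ^ p = 1} := by
    simpa using hζ.pow_eq_one
  rw [IsCyclotomicExtension.iff_singleton]
  refine ⟨⟨ζ, hζ⟩, fun x => Algebra.adjoin_mono hsub ?_⟩
  rw [htop]
  exact Algebra.mem_top

theorem cyclotomicChar_injective
    (hζ : IsPrimitiveRoot ζ p) (hK : IntermediateField.adjoin F {ζ} = ⊤)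
    (hω : ∀ σ : K ≃ₐ[F] K, σ ζ = ζ ^ (ω σ : ZMod p).val) : Function.Injective ω := by
  intro σ τ h
  have hint : IsIntegral F ζ := (hζ.isIntegral hp.out.pos).tower_top
  have htop := Algebra.adjoin_eq_top_of_intermediateField (S := {ζ})
    (by simpa using hint.isAlgebraic) hK
  have : (σ : K →ₐ[F] K) = τ := AlgHom.ext_of_adjoin_eq_top htop (by
    intro x hx
    rw [Set.mem_singleton_iff.1 hx]
    simp [hω, h])
  ext x
  exact DFunLike.congr_fun this x

theorem card_algEquiv_lt (hζ : IsPrimitiveRoot ζ p) (hK : IntermediateField.adjoin F {ζ} = ⊤)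
    (hω : ∀ σ : K ≃ₐ[F] K, σ ζ = ζ ^ (ω σ : ZMod p).val) : Nat.card (K ≃ₐ[F] K) < p := by
  have := Nat.card_le_card_of_injective ω (cyclotomicChar_injective hζ hK hω)
  rw [Nat.card_eq_fintype_card (α := (ZMod p)ˣ), ZMod.card_units] at this
  have := hp.out.pos
  omega

end Cyclotomic

namespace IsIntVal

section Uniformizer

variable {p : ℕ} [hp : Fact p.Prime] {K : Type*} [Field K] {w : K → ℤ} {ζ : K}

theorem natCast_sub_mem_fil_one (h : IsIntVal w) (hpw : 0 < w (p : K)) {m n : ℕ}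
    (hn : (m : ZMod p) = n) : (m : K) - n ∈ h.fil 1 := by
  obtain ⟨k, hk⟩ : (p : ℤ) ∣ (m : ℤ) - n := by
    rw [← ZMod.intCast_zmod_eq_zero_iff_dvd]; simp [hn]
  have : (m : K) - n = k * (p : K) := by
    have := congrArg (Int.cast : ℤ → K) hk
    push_cast at this
    rw [this, mul_comm]
  rw [this]
  exact h.mul_mem' (h.intCast_mem k) (Or.inr hpw)

theorem primitiveRoot_mem (h : IsIntVal w) (hζ : IsPrimitiveRoot ζ p) : ζ ∈ h.fil 0 := by
  have h0 := hζ.ne_zero hp.out.ne_zero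
  have h1 := h.pow h0 p
  rw [hζ.pow_eq_one, h.one] at h1
  have := hp.out.ne_zero
  rcases mul_eq_zero.1 h1.symm with h2 | h2
  · exact absurd h2 (by exact_mod_cast this)
  · exact Or.inr h2.ge

theorem val_sub_one_le (h : IsIntVal w) (hζ : IsPrimitiveRoot ζ p) {n : ℕ}
    (hn : ζ ^ n ≠ 1) : w (ζ - 1) ≤ w (ζ ^ n - 1) := by
  have h0 : ζ ^ n - 1 ≠ 0 := sub_ne_zero.2 hn
  rw [← h.mem_fil_of_ne_zero h0, ← mul_geom_sum, mul_comm]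
  exact h.mul_mem' (sum_mem fun i _ => h.pow_mem_zero (h.primitiveRoot_mem hζ) i) (Or.inr le_rfl)

theorem val_pow_sub_one (h : IsIntVal w) (hζ : IsPrimitiveRoot ζ p) {n : ℕ}
    (hn : ζ ^ n ≠ 1) : w (ζ ^ n - 1) = w (ζ - 1) := by
  refine le_antisymm ?_ (h.val_sub_one_le hζ hn)
  have hcop : n.Coprime p := by
    rw [Nat.coprime_comm, hp.out.coprime_iff_not_dvd]
    exact fun hd => hn ((hζ.pow_eq_one_iff_dvd n).2 hd)
  obtain ⟨m, -, hm⟩ := Nat.exists_mul_mod_eq_one_of_coprime hcop hp.out.one_lt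
  have hm' : (ζ ^ n) ^ m = ζ := by
    rw [← pow_mul, ← Nat.div_add_mod (n * m) p, hm, pow_succ, pow_mul, hζ.pow_eq_one, one_pow,
      one_mul]
  have := h.val_sub_one_le (hζ.pow_of_coprime n hcop) (n := m)
    (by rw [hm']; exact hζ.ne_one hp.out.one_lt)
  rwa [hm'] at this

theorem mul_val_primitiveRoot_sub_one (h : IsIntVal w) (hζ : IsPrimitiveRoot ζ p) :
    (p - 1) * w (ζ - 1) = w (p : K) := by
  obtain ⟨n, rfl⟩ : ∃ n, p = n + 1 := ⟨p - 1, (Nat.succ_pred_prime hp.out).symm⟩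
  have hne : ∀ k ∈ Finset.range n, ζ ^ (k + 1) ≠ 1 := fun k hk =>
    hζ.pow_ne_one_of_pos_of_lt k.succ_ne_zero (by simpa using hk)
  have h1 := hζ.prod_one_sub_pow_eq_order
  have h2 := congrArg w h1
  rw [h.prod _ _ fun k hk => sub_ne_zero.2 (hne k hk).symm, Finset.sum_congr rfl fun k hk => by
    rw [← neg_sub, h.neg, h.val_pow_sub_one hζ (hne k hk)]] at h2
  simpa using h2

end Uniformizer

section EigenProj

variable {p : ℕ} [hp : Fact p.Prime] {F K : Type*} [Field F] [Field K] [Algebra F K]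
  {w : K → ℤ} {ζ : K} {ω : (K ≃ₐ[F] K) → (ZMod p)ˣ}

theorem eigenCoeff_mul_sub_mem (h : IsIntVal w) (hpw : 0 < w (p : K)) (hζ : IsPrimitiveRoot ζ p)
    (hω : ∀ σ : K ≃ₐ[F] K, σ ζ = ζ ^ (ω σ : ZMod p).val) (σ : K ≃ₐ[F] K) :
    eigenCoeff ω σ * σ (ζ - 1) -
      ((Nat.card (K ≃ₐ[F] K) : ZMod p)⁻¹).val * (ζ - 1) ∈ h.fil (w (ζ - 1) + 1) := by
  set g := ∑ i ∈ Finset.range (ω σ : ZMod p).val, ζ ^ i with hg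
  have hlam : ζ - 1 ∈ h.fil 1 := by
    have h1 := h.mul_val_primitiveRoot_sub_one hζ
    have h2 : (1 : ℤ) < p := by exact_mod_cast hp.out.one_lt
    refine Or.inr ?_
    by_contra! h3
    nlinarith
  have h1 : σ (ζ - 1) = g * (ζ - 1) := by
    rw [map_sub, map_one, hω, mul_comm, hg, mul_geom_sum]
  have h2 : g - (ω σ : ZMod p).val ∈ h.fil 1 := by
    have : g - (ω σ : ZMod p).val = ∑ i ∈ Finset.range (ω σ : ZMod p).val, (ζ ^ i - 1) := by
      simp [hg]
    rw [this]
    refine sum_mem fun i _ => ?_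
    rw [← mul_geom_sum, mul_comm]
    exact h.mul_mem' (sum_mem fun i _ => h.pow_mem_zero (h.primitiveRoot_mem hζ) i) hlam
  have h3 : ((eigenCoeff ω σ * (ω σ : ZMod p).val : ℕ) : K) -
      ((Nat.card (K ≃ₐ[F] K) : ZMod p)⁻¹).val ∈ h.fil 1 := by
    apply h.natCast_sub_mem_fil_one hpw
    push_cast
    rw [natCast_eigenCoeff, ZMod.natCast_zmod_val, ZMod.natCast_zmod_val, mul_assoc,
      Units.inv_mul, mul_one]
  have h4 : (eigenCoeff ω σ * σ (ζ - 1) -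
      ((Nat.card (K ≃ₐ[F] K) : ZMod p)⁻¹).val * (ζ - 1) : K) =
      (ζ - 1) * (eigenCoeff ω σ * (g - (ω σ : ZMod p).val) +
        (((eigenCoeff ω σ * (ω σ : ZMod p).val : ℕ) : K) -
      ((Nat.card (K ≃ₐ[F] K) : ZMod p)⁻¹).val)) := by
    rw [h1]; push_cast; ring
  rw [h4]
  exact h.mul_mem (Or.inr le_rfl) (add_mem (h.mul_mem' (h.natCast_mem _) h2) h3)

theorem map_mem_fil (h : IsIntVal w) {σ : K ≃ₐ[F] K} (hσ : ∀ x, w (σ x) = w x) {j : ℤ} {x : K}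
    (hx : x ∈ h.fil j) : σ x ∈ h.fil j := by
  rcases hx with rfl | hx
  · simp
  · exact Or.inr (by rwa [hσ])

theorem mul_inv_mem (h : IsIntVal w) {x y : K} {j : ℤ} (hy : y ≠ 0) (hx : x ∈ h.fil j) :
    x * y⁻¹ ∈ h.fil (j - w y) :=
  h.mul_mem hx (Or.inr (by rw [h.inv hy]))

variable [Fintype (K ≃ₐ[F] K)]

/-- The effect of the eigenspace projector on leading terms. -/
theorem eigenProj_sub_one_sub_mem (h : IsIntVal w) (hσ : ∀ (σ : K ≃ₐ[F] K) x, w (σ x) = w x)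
    (hpw : 0 < w (p : K)) (hζ : IsPrimitiveRoot ζ p)
    (hω : ∀ σ : K ≃ₐ[F] K, σ ζ = ζ ^ (ω σ : ZMod p).val) {j : ℤ} (hj : 1 ≤ j) {u : Kˣ} {t : K}
    (ht : t ∈ h.fil j) (hu : (u : K) - 1 - t ∈ h.fil (j + 1)) :
    (eigenProj ω u : K) - 1 - (ζ - 1) * (((Nat.card (K ≃ₐ[F] K) : ZMod p)⁻¹).val *
      ∑ σ : K ≃ₐ[F] K, σ (t * (ζ - 1)⁻¹)) ∈ h.fil (j + 1) := by
  have hl0 : ζ - 1 ≠ 0 := sub_ne_zero.2 (hζ.ne_one hp.out.one_lt)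
  rw [coe_eigenProj]
  have h1 := h.prod_sub_one_sub_mem hj Finset.univ
    (fun σ : K ≃ₐ[F] K => σ (u : K) ^ eigenCoeff ω σ) (fun σ => eigenCoeff ω σ * σ t)
    (fun σ _ => h.mul_mem' (h.natCast_mem _) (h.map_mem_fil (hσ σ) ht))
    (fun σ _ => h.pow_sub_one_sub_mem hj (h.map_mem_fil (hσ σ) ht)
      (by simpa using h.map_mem_fil (hσ σ) hu) _)
  have h2 : ∑ σ : K ≃ₐ[F] K, (eigenCoeff ω σ * σ t -
      (ζ - 1) * (((Nat.card (K ≃ₐ[F] K) : ZMod p)⁻¹).val * σ (t * (ζ - 1)⁻¹))) ∈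
        h.fil (j + 1) := by
    refine sum_mem fun σ _ => ?_
    have h3 := h.mul_mem (h.eigenCoeff_mul_sub_mem hpw hζ hω σ)
      (h.map_mem_fil (hσ σ) (h.mul_inv_mem hl0 ht))
    rw [show w (ζ - 1) + 1 + (j - w (ζ - 1)) = j + 1 by ring] at h3
    convert h3 using 1
    have h4 : σ t = σ (ζ - 1) * σ (t * (ζ - 1)⁻¹) := by
      rw [← map_mul, mul_comm t, mul_inv_cancel_left₀ hl0]
    rw [h4]; ring
  rw [Finset.sum_sub_distrib, ← Finset.mul_sum, ← Finset.mul_sum] at h2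
  convert add_mem h1 h2 using 1
  ring

theorem mul_sum_mem (h : IsIntVal w) (hσ : ∀ (σ : K ≃ₐ[F] K) x, w (σ x) = w x)
    (hζ : IsPrimitiveRoot ζ p) {j : ℤ} {t : K} (ht : t ∈ h.fil j) (n : ℕ) :
    (ζ - 1) * (n * ∑ σ : K ≃ₐ[F] K, σ (t * (ζ - 1)⁻¹)) ∈ h.fil j := by
  have hl0 : ζ - 1 ≠ 0 := sub_ne_zero.2 (hζ.ne_one hp.out.one_lt)
  have := h.mul_mem (x := ζ - 1) (Or.inr le_rfl) (h.mul_mem' (h.natCast_mem n)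
    (sum_mem fun (σ : K ≃ₐ[F] K) (_ : σ ∈ Finset.univ) =>
      h.map_mem_fil (hσ σ) (h.mul_inv_mem hl0 ht)))
  simpa using this

/-- The projector fixes leading terms of the form `(ζ - 1) * a` with `a` in the base field. -/
theorem eigenProj_sub_one_sub_algebraMap_mem (h : IsIntVal w)
    (hσ : ∀ (σ : K ≃ₐ[F] K) x, w (σ x) = w x) (hpw : 0 < w (p : K)) (hζ : IsPrimitiveRoot ζ p)
    (hω : ∀ σ : K ≃ₐ[F] K, σ ζ = ζ ^ (ω σ : ZMod p).val)
    (hd : (Nat.card (K ≃ₐ[F] K) : ZMod p) ≠ 0) {j : ℤ} (hj : 1 ≤ j) {u : Kˣ} {a : F}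
    (ha : (ζ - 1) * algebraMap F K a ∈ h.fil j)
    (hu : (u : K) - 1 - (ζ - 1) * algebraMap F K a ∈ h.fil (j + 1)) :
    (eigenProj ω u : K) - 1 - (ζ - 1) * algebraMap F K a ∈ h.fil (j + 1) := by
  have hl0 : ζ - 1 ≠ 0 := sub_ne_zero.2 (hζ.ne_one hp.out.one_lt)
  have h1 := h.eigenProj_sub_one_sub_mem hσ hpw hζ hω hj ha hu
  rw [mul_right_comm, mul_inv_cancel₀ hl0, one_mul] at h1
  simp only [AlgEquiv.commutes, Finset.sum_const, Finset.card_univ, nsmul_eq_mul] at h1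
  rw [← Nat.card_eq_fintype_card, ← mul_assoc] at h1
  have h2 : ((((Nat.card (K ≃ₐ[F] K) : ZMod p)⁻¹).val * Nat.card (K ≃ₐ[F] K) : ℕ) : K) -
      (1 : ℕ) ∈ h.fil 1 := by
    apply h.natCast_sub_mem_fil_one hpw
    push_cast
    rw [ZMod.natCast_zmod_val, inv_mul_cancel₀ hd]
  have h3 := h.mul_mem ha h2
  convert add_mem h1 h3 using 1
  push_cast
  ring

/-- The projector maps to leading terms of the form `(ζ - 1) * a` with `a` in the base field. -/
theorem exists_eigenProj_sub_one_sub_algebraMap_mem [FiniteDimensional F K] [IsGalois F K]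
    (h : IsIntVal w)
    (hσ : ∀ (σ : K ≃ₐ[F] K) x, w (σ x) = w x) (hpw : 0 < w (p : K)) (hζ : IsPrimitiveRoot ζ p)
    (hω : ∀ σ : K ≃ₐ[F] K, σ ζ = ζ ^ (ω σ : ZMod p).val) {j : ℤ} (hj : 1 ≤ j) {u : Kˣ}
    (hu : (u : K) - 1 ∈ h.fil j) :
    ∃ a : F, (ζ - 1) * algebraMap F K a ∈ h.fil j ∧
      (eigenProj ω u : K) - 1 - (ζ - 1) * algebraMap F K a ∈ h.fil (j + 1) := by
  refine ⟨((Nat.card (K ≃ₐ[F] K) : ZMod p)⁻¹).val *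
    Algebra.trace F K (((u : K) - 1) * (ζ - 1)⁻¹), ?_⟩
  have h1 := h.eigenProj_sub_one_sub_mem hσ hpw hζ hω hj hu (u := u) (by simp)
  have h2 := h.mul_sum_mem hσ hζ hu ((Nat.card (K ≃ₐ[F] K) : ZMod p)⁻¹).val
  have h3 : algebraMap F K (((Nat.card (K ≃ₐ[F] K) : ZMod p)⁻¹).val *
    Algebra.trace F K (((u : K) - 1) * (ζ - 1)⁻¹)) =
      ((Nat.card (K ≃ₐ[F] K) : ZMod p)⁻¹).val *
        ∑ σ : K ≃ₐ[F] K, σ (((u : K) - 1) * (ζ - 1)⁻¹) := by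
    rw [map_mul, map_natCast, trace_eq_sum_automorphisms]
    congr! 2
    exact Finset.ext fun _ => by simp
  rw [h3]
  exact ⟨h2, h1⟩

end EigenProj

theorem eigenProj_mem_unitFil {p : ℕ} {F K : Type*} [Field F] [Field K] [Algebra F K]
    [Fintype (K ≃ₐ[F] K)] {w : K → ℤ} {ω : (K ≃ₐ[F] K) → (ZMod p)ˣ} (h : IsIntVal w)
    (hσ : ∀ (σ : K ≃ₐ[F] K) x, w (σ x) = w x) {j : ℤ} (hj : 1 ≤ j) {u : Kˣ}
    (hu : u ∈ h.unitFil hj) : eigenProj ω u ∈ h.unitFil hj := by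
  rw [eigenProj_apply]
  refine Subgroup.prod_mem _ fun σ _ => Subgroup.pow_mem _ ?_ _
  rw [mem_unitFil] at hu ⊢
  simpa using h.map_mem_fil (hσ σ) hu

end IsIntVal

/-- A map that is injective and surjective modulo subgroups identifies relative indices. -/
theorem Subgroup.relIndex_eq_of_map {A G : Type*} [AddGroup A] [Group G] {A₁ A₂ : AddSubgroup A}
    {H₁ H₂ : Subgroup G} (g : A → G) (hg : ∀ a ∈ A₁, g a ∈ H₁)
    (hab : ∀ a ∈ A₁, ∀ b ∈ A₁, (g a)⁻¹ * g b ∈ H₂ ↔ -a + b ∈ A₂)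
    (hsurj : ∀ x ∈ H₁, ∃ a ∈ A₁, (g a)⁻¹ * x ∈ H₂) : H₂.relIndex H₁ = A₂.relIndex A₁ := by
  symm
  let φ : A₁ ⧸ A₂.addSubgroupOf A₁ → H₁ ⧸ H₂.subgroupOf H₁ :=
    Quotient.map' (fun a => ⟨g a, hg a a.2⟩) fun a b hr => by
      rw [QuotientAddGroup.leftRel_apply] at hr
      rw [QuotientGroup.leftRel_apply]
      exact (hab a a.2 b b.2).2 hr
  refine Nat.card_eq_of_bijective φ ⟨?_, ?_⟩
  · rintro ⟨a⟩ ⟨b⟩ hr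
    have hr' : (⟨g a, hg a a.2⟩ : H₁)⁻¹ * ⟨g b, hg b b.2⟩ ∈ H₂.subgroupOf H₁ :=
      QuotientGroup.eq.1 hr
    exact QuotientAddGroup.eq.2 ((hab a a.2 b b.2).1 hr')
  · rintro ⟨x⟩
    obtain ⟨a, ha, hax⟩ := hsurj x x.2
    exact ⟨QuotientAddGroup.mk ⟨a, ha⟩, QuotientGroup.eq.2 hax⟩

namespace IsIntVal

section EigenFil

variable {p : ℕ} [hp : Fact p.Prime] {F K : Type*} [Field F] [Field K] [Algebra F K]
  {w : K → ℤ} {ζ : K} {ω : (K ≃ₐ[F] K) → (ZMod p)ˣ} [Fintype (K ≃ₐ[F] K)]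

/-- The image of `U_j` in `Kˣ/(Kˣ)ᵖ` under the projector onto the `ω`-eigenspace. -/
noncomputable def eigenFil (h : IsIntVal w) (ω : (K ≃ₐ[F] K) → (ZMod p)ˣ) {j : ℤ} (hj : 1 ≤ j) :
    Subgroup (KmodP p K) :=
  (h.unitFil hj).map (eigenClass ω)

theorem eigenFil_anti (h : IsIntVal w) {i j : ℤ} (hi : 1 ≤ i) (hij : i ≤ j) :
    h.eigenFil ω (hi.trans hij) ≤ h.eigenFil ω hi :=
  Subgroup.map_mono fun _ hx => h.fil_anti hij hx

theorem omegaEigenspace_inter_UbarSet (h : IsIntVal w)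
    (hσ : ∀ (σ : K ≃ₐ[F] K) x, w (σ x) = w x)
    (hω : ∀ σ τ : K ≃ₐ[F] K, ω (σ * τ) = ω σ * ω τ)
    (hd : (Nat.card (K ≃ₐ[F] K) : ZMod p) ≠ 0) {j : ℤ} (hj : 1 ≤ j) :
    omegaEigenspace p F K ω ∩ UbarSet p K w j = h.eigenFil ω hj := by
  ext c
  constructor
  · rintro ⟨⟨x, rfl, hx⟩, x', hx', u, y, hy, hu, hxu⟩
    have hu' : u - 1 ∈ h.fil j := hu
    have hu0 := (h.unit_of_sub_one_mem hj hu').1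
    have h1 : (QuotientGroup.mk x' : KmodP p K) = QuotientGroup.mk (Units.mk0 u hu0) :=
      KmodP.mk_eq_iff.2 ⟨y, hy, hxu⟩
    refine ⟨Units.mk0 u hu0, hu', ?_⟩
    rw [← eigenClass_eq_of_mk_eq ω (hx'.symm.trans h1), eigenClass_eq_mk ω hd hx]
  · rintro ⟨u, hu, rfl⟩
    refine ⟨⟨eigenProj ω u, rfl, eigenProj_isEigen ω hω u⟩, eigenProj ω u, rfl,
      eigenProj ω u, 1, one_ne_zero, h.eigenProj_mem_unitFil hσ hj hu, by simp⟩

/-- At levels divisible by `p` below the critical bound the filtration does not jump. -/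
theorem eigenFil_eq_of_dvd [Algebra ℚ_[p] K] [FiniteDimensional ℚ_[p] K] (h : IsIntVal w)
    (hodd : Odd p) {R k : ℤ} {π : K} (hπ0 : π ≠ 0) (hπ : w π = 1)
    (hR : (p - 1) * R = w (p : K)) (hpw : 0 < w (p : K)) (hk : 1 ≤ k) (hkR : k < R)
    (hj : 1 ≤ p * k) :
    h.eigenFil ω hj = h.eigenFil ω (hj.trans (Int.le_add_one le_rfl)) := by
  refine le_antisymm ?_ (h.eigenFil_anti hj (Int.le_add_one le_rfl))
  rintro _ ⟨u, hu, rfl⟩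
  obtain ⟨u', y, hy, hu', huy⟩ := h.exists_eq_mul_pow hodd hπ0 hπ hR hpw hk hkR hu
  have hu0 := (h.unit_of_sub_one_mem (by omega) hu').1
  exact ⟨Units.mk0 u' hu0, hu', (eigenClass_eq_of_mk_eq ω
    (KmodP.mk_eq_iff.2 ⟨y, hy, huy⟩)).symm⟩

/-- The class of a unit with leading term `(ζ - 1) * a` lies in the next filtration step only if
this leading term vanishes. -/
theorem eigenClass_mem_eigenFil_iff
    (h : IsIntVal w) (hσ : ∀ (σ : K ≃ₐ[F] K) x, w (σ x) = w x) (hpw : 0 < w (p : K))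
    (hζ : IsPrimitiveRoot ζ p) (hω : ∀ σ : K ≃ₐ[F] K, σ ζ = ζ ^ (ω σ : ZMod p).val)
    (hd : (Nat.card (K ≃ₐ[F] K) : ZMod p) ≠ 0)
    (hodd : Odd p) {j : ℤ} (hj : 1 ≤ j)
    (hjR : j < p * w (ζ - 1)) (hpj : ¬ (p : ℤ) ∣ j) (hj' : 1 ≤ j + 1) {a : F} {u : Kˣ}
    (ha : (ζ - 1) * algebraMap F K a ∈ h.fil j)
    (hu : (u : K) - 1 - (ζ - 1) * algebraMap F K a ∈ h.fil (j + 1)) :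
    eigenClass ω u ∈ h.eigenFil ω hj' ↔ (ζ - 1) * algebraMap F K a ∈ h.fil (j + 1) := by
  have h1 := h.eigenProj_sub_one_sub_algebraMap_mem hσ hpw hζ hω hd hj ha hu
  constructor
  · rintro ⟨u', hu', he⟩
    obtain ⟨y, hy, hyu⟩ := KmodP.mk_eq_iff.1 he.symm
    have h2 := (h.unitFil hj').inv_mem (h.eigenProj_mem_unitFil (ω := ω) hσ hj' hu')
    have h3 := h.mul_sub_one_sub_mem hj ha (zero_mem _) h1 (y := ((eigenProj ω u')⁻¹ : Kˣ))
      (by rw [sub_zero]; exact h2)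
    have h4 : (eigenProj ω u : K) * ((eigenProj ω u')⁻¹ : Kˣ) = y ^ p := by
      rw [hyu, mul_right_comm, Units.mul_inv, one_mul]
    rw [h4, add_zero] at h3
    by_contra hc
    refine hpj (h.dvd_of_pow_sub_one hodd (h.mul_val_primitiveRoot_sub_one hζ) hpw hj hjR (y := y)
      ?_ fun h5 => hc ?_)
    · simpa using add_mem (h.fil_anti (by omega) h3) ha
    · simpa using sub_mem h5 h3
  · intro ha'
    refine ⟨eigenProj ω u, ?_, eigenClass_eigenProj ω hd (cyclotomicChar_mul hζ hω) u⟩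
    have := add_mem h1 ha'
    rw [sub_add_cancel] at this
    exact this

variable [FiniteDimensional F K] [IsGalois F K]

/-- The filtration does not jump at levels outside the valuations of `(ζ - 1) * a`, with `a` in
the base field. -/
theorem eigenFil_eq_of_forall_ne
    (h : IsIntVal w) (hσ : ∀ (σ : K ≃ₐ[F] K) x, w (σ x) = w x) (hpw : 0 < w (p : K))
    (hζ : IsPrimitiveRoot ζ p) (hω : ∀ σ : K ≃ₐ[F] K, σ ζ = ζ ^ (ω σ : ZMod p).val)
    (hd : (Nat.card (K ≃ₐ[F] K) : ZMod p) ≠ 0)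
    {j : ℤ} (hj : 1 ≤ j)
    (hne : ∀ a : F, a ≠ 0 → w ((ζ - 1) * algebraMap F K a) ≠ j) :
    h.eigenFil ω hj = h.eigenFil ω (hj.trans (Int.le_add_one le_rfl)) := by
  refine le_antisymm ?_ (h.eigenFil_anti hj (Int.le_add_one le_rfl))
  rintro _ ⟨u, hu, rfl⟩
  obtain ⟨a, ha, hau⟩ := h.exists_eigenProj_sub_one_sub_algebraMap_mem hσ hpw hζ hω hj hu
  refine ⟨eigenProj ω u, ?_, eigenClass_eigenProj ω hd (cyclotomicChar_mul hζ hω) u⟩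
  have ha' : (ζ - 1) * algebraMap F K a ∈ h.fil (j + 1) := by
    rcases ha with ha | ha
    · exact Or.inl ha
    · by_cases ha0 : a = 0
      · exact Or.inl (by simp [ha0])
      · have := hne a ha0
        exact Or.inr (by omega)
  have := add_mem hau ha'
  rw [sub_add_cancel] at this
  exact this

theorem relIndex_eigenFil
    (h : IsIntVal w) (hσ : ∀ (σ : K ≃ₐ[F] K) x, w (σ x) = w x) (hpw : 0 < w (p : K))
    (hζ : IsPrimitiveRoot ζ p) (hω : ∀ σ : K ≃ₐ[F] K, σ ζ = ζ ^ (ω σ : ZMod p).val)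
    (hd : (Nat.card (K ≃ₐ[F] K) : ZMod p) ≠ 0)
    (hodd : Odd p) {j : ℤ} (hj : 1 ≤ j)
    (hjR : j < p * w (ζ - 1)) (hpj : ¬ (p : ℤ) ∣ j) (hj' : 1 ≤ j + 1) :
    (h.eigenFil ω hj').relIndex (h.eigenFil ω hj) =
      ((h.comap (algebraMap F K)).fil (j + 1 - w (ζ - 1))).relIndex
        ((h.comap (algebraMap F K)).fil (j - w (ζ - 1))) := by
  have hl0 : ζ - 1 ≠ 0 := sub_ne_zero.2 (hζ.ne_one hp.out.one_lt)
  have hfil : ∀ (i : ℤ) (a : F), a ∈ (h.comap (algebraMap F K)).fil (i - w (ζ - 1)) ↔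
      (ζ - 1) * algebraMap F K a ∈ h.fil i := by
    intro i a
    by_cases ha : a = 0
    · simp [ha]
    · have ha' : algebraMap F K a ≠ 0 := by simpa using ha
      rw [mem_fil_of_ne_zero _ ha, mem_fil_of_ne_zero _ (mul_ne_zero hl0 ha'), h.mul _ _ hl0 ha']
      constructor <;> intro <;> omega
  have hex : ∀ a : F, (ζ - 1) * algebraMap F K a ∈ h.fil j →
      ∃ u : Kˣ, (u : K) = 1 + (ζ - 1) * algebraMap F K a := fun a ha =>
    ⟨Units.mk0 _ (h.unit_of_sub_one_mem (x := 1 + (ζ - 1) * algebraMap F K a) hj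
      (by simpa using ha)).1, rfl⟩
  choose! g hg using hex
  have hgm : ∀ a : F, (ζ - 1) * algebraMap F K a ∈ h.fil j → g a ∈ h.unitFil hj := by
    intro a ha
    rw [mem_unitFil, hg a ha]
    simpa using ha
  have key : ∀ (a : F) (x : Kˣ) (b : F), (ζ - 1) * algebraMap F K a ∈ h.fil j →
      (ζ - 1) * algebraMap F K b ∈ h.fil j →
      (x : K) - 1 - (ζ - 1) * algebraMap F K b ∈ h.fil (j + 1) →
      ((eigenClass ω (g a))⁻¹ * eigenClass ω x ∈ h.eigenFil ω hj' ↔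
        (ζ - 1) * algebraMap F K (-a + b) ∈ h.fil (j + 1)) := by
    intro a x b ha hb hx
    rw [← map_inv, ← map_mul]
    have hmem : (ζ - 1) * algebraMap F K (-a + b) ∈ h.fil j := by
      rw [map_add, map_neg, mul_add, mul_neg]
      exact add_mem (neg_mem ha) hb
    refine h.eigenClass_mem_eigenFil_iff hσ hpw hζ hω hd hodd hj hjR hpj hj' hmem ?_
    have h1 : ((g a)⁻¹ : Kˣ) - 1 - -((ζ - 1) * algebraMap F K a) ∈ h.fil (j + 1) := by
      have h2 := h.mul_mem ((h.unitFil hj).inv_mem (hgm a ha)) ha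
      have h3 : (((g a)⁻¹ : Kˣ) : K) * (1 + (ζ - 1) * algebraMap F K a) = 1 := by
        rw [← hg a ha, Units.inv_mul]
      convert neg_mem (h.fil_anti (show j + 1 ≤ j + j by omega) h2) using 1
      linear_combination h3
    rw [Units.val_mul, map_add, map_neg, mul_add, mul_neg]
    exact h.mul_sub_one_sub_mem hj (neg_mem ha) hb h1 hx
  refine Subgroup.relIndex_eq_of_map (fun a => eigenClass ω (g a)) ?_ ?_ ?_
  · intro a ha
    exact Subgroup.mem_map_of_mem _ (hgm a ((hfil j a).1 ha))
  · intro a ha b hb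
    rw [hfil] at ha hb ⊢
    exact key a (g b) b ha hb (by rw [hg b hb]; simp)
  · rintro _ ⟨x, hx, rfl⟩
    obtain ⟨a, ha, hax⟩ := h.exists_eigenProj_sub_one_sub_algebraMap_mem hσ hpw hζ hω hj hx
    refine ⟨a, (hfil j a).2 ha, ?_⟩
    rw [← eigenClass_eigenProj ω hd (cyclotomicChar_mul hζ hω) x, key a _ a ha ha hax]
    simp

end EigenFil

section BaseField

variable {F : Type*} [Field F] {v : F → ℤ}

theorem relIndex_fil_of_dvd (h : IsIntVal v) {s : ℕ} (hs0 : 0 < s) (hs : ∀ z, z ≠ 0 → (s : ℤ) ∣ v z)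
    {z : F} (hz : z ≠ 0) (hvz : v z = s) (t : ℤ) :
    (h.fil (s * t + 1)).relIndex (h.fil (s * t)) = (h.fil s).relIndex (h.fil 0) := by
  have h1 : h.fil (s * t + 1) = h.fil (s + v (z ^ t)) := by
    rw [h.zpow hz, hvz]
    ext x
    by_cases hx : x = 0
    · simp [hx]
    rw [mem_fil_of_ne_zero _ hx, mem_fil_of_ne_zero _ hx]
    obtain ⟨m, hm⟩ := hs x hx
    have hs0' : (0 : ℤ) < s := by exact_mod_cast hs0
    rw [hm]
    constructor
    · intro hlt
      have : t < m := lt_of_mul_lt_mul_left (by omega) hs0'.le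
      nlinarith
    · intro hle
      linarith [mul_comm t (s : ℤ)]
  rw [h1, ← h.relIndex_fil_shift (zpow_ne_zero t hz) s 0, h.zpow hz, hvz, zero_add, mul_comm t]

theorem relIndex_fil_eq_pow {p : ℕ} [hp : Fact p.Prime] [Algebra ℚ_[p] F]
    [FiniteDimensional ℚ_[p] F] (h : IsIntVal v) {s e f : ℕ} (hs : 0 < s) (he : 0 < e)
    {z : F} (hz : z ≠ 0) (hvz : v z = s) (hv : v (p : F) = (e * s : ℕ))
    (hef : e * f = Module.finrank ℚ_[p] F) :
    (h.fil s).relIndex (h.fil 0) = p ^ f := by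
  have h1 := h.relIndex_fil_pow hz (by omega) e
  have h2 := h.relIndex_fil_prime (p := p) (by rw [hv]; positivity)
  rw [hvz] at h1
  rw [hv, ← hef, Nat.cast_mul, h1, mul_comm, pow_mul] at h2
  exact Nat.pow_left_injective he.ne' h2

end BaseField

end IsIntVal

section BExp

variable {p : ℕ}

theorem exists_bExp_eq (hp : 2 ≤ p) {i : ℕ} (hi : 1 ≤ i) :
    ∃ q r : ℕ, r + 1 < p ∧ i + q = p * q + r + 1 ∧ bExp p i = p * q + r + 1 := by
  have h1 := Nat.div_add_mod (i - 1) (p - 1)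
  have h2 := Nat.mod_lt (i - 1) (show 0 < p - 1 by omega)
  have h3 : p * ((i - 1) / (p - 1)) = (p - 1) * ((i - 1) / (p - 1)) + (i - 1) / (p - 1) := by
    conv_lhs => rw [show p = (p - 1) + 1 by omega, add_one_mul]
    rfl
  refine ⟨(i - 1) / (p - 1), (i - 1) % (p - 1), by omega, by omega, ?_⟩
  unfold bExp
  omega

theorem not_dvd_bExp (hp : 2 ≤ p) {i : ℕ} (hi : 1 ≤ i) : ¬ p ∣ bExp p i := by
  obtain ⟨q, r, hr, -, h⟩ := exists_bExp_eq hp hi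
  rw [h, add_assoc, Nat.dvd_add_right (dvd_mul_right p q)]
  exact fun hd => absurd (Nat.le_of_dvd (by omega) hd) (by omega)

theorem mul_bExp_lt (hp : 2 ≤ p) {i : ℕ} (hi : 1 ≤ i) : (p - 1) * bExp p i < p * i := by
  obtain ⟨q, r, hr, h1, h⟩ := exists_bExp_eq hp hi
  obtain ⟨n, rfl⟩ : ∃ n, p = n + 1 := ⟨p - 1, by omega⟩
  rw [h, Nat.add_sub_cancel]
  have : i = n * q + r + 1 := by linarith
  rw [this]
  nlinarith

theorem dvd_of_bExp_lt_of_lt_bExp (hp : 2 ≤ p) {i m : ℕ} (hi : 1 ≤ i) (h1 : bExp p (i - 1) < m)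
    (h2 : m < bExp p i) : p ∣ m := by
  obtain ⟨q, r, hr, hi1, hb⟩ := exists_bExp_eq hp hi
  rcases hi.eq_or_lt with rfl | hi'
  · simp [bExp] at h2
    omega
  obtain ⟨q', r', hr', hi1', hb'⟩ := exists_bExp_eq hp (i := i - 1) (by omega)
  refine ⟨q, ?_⟩
  obtain ⟨n, rfl⟩ : ∃ n, p = n + 1 := ⟨p - 1, by omega⟩
  have hi2 : i = n * q + r + 1 := by linarith
  have hi3 : i = n * q' + r' + 2 := by
    have : i - 1 = n * q' + r' + 1 := by linarith
    omega
  have : q = q' ∨ q = q' + 1 := by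
    have h3 : q' ≤ q := by
      by_contra! hlt
      nlinarith
    have h4 : q < q' + 2 := by
      by_contra! hlt
      nlinarith
    omega
  rcases this with rfl | rfl
  · omega
  · rw [hb] at h2
    rw [hb'] at h1
    have : n * (q' + 1) = n * q' + n := by ring
    have : (n + 1) * (q' + 1) = (n + 1) * q' + n + 1 := by ring
    omega

end BExp

namespace IsIntVal

/-- If the values of `w` on the base field are divisible by `s`, then `s` divides the degree. -/
theorem dvd_card_algEquiv {F K : Type*} [Field F] [Field K] [Algebra F K] [FiniteDimensional F K]
    [IsGalois F K] {w : K → ℤ} (h : IsIntVal w) (hσ : ∀ (σ : K ≃ₐ[F] K) x, w (σ x) = w x)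
    {π : K} (hπ0 : π ≠ 0) (hπ : w π = 1) {s : ℕ}
    (hs : ∀ z : F, z ≠ 0 → (s : ℤ) ∣ w (algebraMap F K z)) : s ∣ Nat.card (K ≃ₐ[F] K) := by
  have h1 := hs (Algebra.norm F π) (Algebra.norm_ne_zero_iff.2 hπ0)
  rw [Algebra.norm_eq_prod_automorphisms, h.prod _ _ fun σ _ => by simpa using hπ0] at h1
  simp only [hσ, hπ, Finset.sum_const, Finset.card_univ, nsmul_eq_mul, mul_one] at h1
  rw [Nat.card_eq_fintype_card]
  exact_mod_cast h1

end IsIntVal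

/-- For every `1 ≤ i ≤ e`, the `𝔽_p`-dimension of
`V_{pe₁s−s·b^(i)}/V_{pe₁s−s·b^(i)+1}` equals `f` (equivalently, since these are
elementary abelian `p`-groups, the cardinality drops by a factor `p^f`), and moreover
`V_{pe₁s−b^(i−1)·s} = V_{pe₁s−b^(i)·s+1}`, where `V_i = V ∩ Ū_i` and `b^(0) = 0`. -/
theorem statement10 (p : ℕ) [hp : Fact p.Prime] (hodd : Odd p)
    (F : Type*) [Field F] [Algebra ℚ_[p] F] [FiniteDimensional ℚ_[p] F]
    (hreg : ¬ ∃ z : F, IsPrimitiveRoot z p)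
    (K : Type*) [Field K] [Algebra F K]
    (ζ : K) (hζ : IsPrimitiveRoot ζ p)
    (hKgen : IntermediateField.adjoin F {ζ} = ⊤)
    (ω : (K ≃ₐ[F] K) → (ZMod p)ˣ)
    (hω : ∀ σ : K ≃ₐ[F] K, σ ζ = ζ ^ (ω σ : ZMod p).val)
    (w : K → ℤ) (hw0 : w 0 = 0)
    (hwmul : ∀ x y : K, x ≠ 0 → y ≠ 0 → w (x * y) = w x + w y)
    (hwadd : ∀ x y : K, x ≠ 0 → y ≠ 0 → x + y ≠ 0 → min (w x) (w y) ≤ w (x + y))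
    (hwsurj : ∃ π : K, π ≠ 0 ∧ w π = 1)
    (s : ℕ) (hs : 0 < s)
    (hsdvd : ∀ z : F, z ≠ 0 → (s : ℤ) ∣ w (algebraMap F K z))
    (hsval : ∃ z : F, z ≠ 0 ∧ w (algebraMap F K z) = (s : ℤ))
    (e : ℕ) (he : 0 < e) (hew : w (algebraMap F K (p : F)) = (e * s : ℕ))
    (f : ℕ) (hf : 0 < f) (hef : e * f = Module.finrank ℚ_[p] F)
    (e1s : ℕ) (he1s : (p - 1) * e1s = e * s)
    :
    ∀ i : ℕ, 1 ≤ i → i ≤ e →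
      (Nat.card ↥(omegaEigenspace p F K ω ∩
          UbarSet p K w (((p * e1s : ℕ) : ℤ) - s * bExp p i)) =
        p ^ f *
          Nat.card ↥(omegaEigenspace p F K ω ∩
            UbarSet p K w (((p * e1s : ℕ) : ℤ) - s * bExp p i + 1))) ∧
      omegaEigenspace p F K ω ∩
          UbarSet p K w (((p * e1s : ℕ) : ℤ) - bExp p (i - 1) * s) =
        omegaEigenspace p F K ω ∩
          UbarSet p K w (((p * e1s : ℕ) : ℤ) - bExp p i * s + 1) := by
  have h : IsIntVal w := ⟨hwmul, hwadd⟩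
  have hcyc := isCyclotomicExtension_of_adjoin_eq_top hζ hKgen
  have : FiniteDimensional F K := IsCyclotomicExtension.finiteDimensional {p} F K
  have : IsGalois F K := IsCyclotomicExtension.isGalois {p} F K
  let _ : Algebra ℚ_[p] K := ((algebraMap F K).comp (algebraMap ℚ_[p] F)).toAlgebra
  have : IsScalarTower ℚ_[p] F K := IsScalarTower.of_algebraMap_eq fun _ => rfl
  have : FiniteDimensional ℚ_[p] K := FiniteDimensional.trans ℚ_[p] F K
  have hp2 : 2 ≤ p := hp.out.two_le
  obtain ⟨π, hπ0, hπ⟩ := hwsurj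
  obtain ⟨z, hz0, hz⟩ := hsval
  have hwp : w (p : K) = (e * s : ℕ) := by rw [← hew, map_natCast]
  have hpw : 0 < w (p : K) := by rw [hwp]; positivity
  have hσ : ∀ (σ : K ≃ₐ[F] K) x, w (σ x) = w x := fun σ x =>
    h.algEquiv_eq hpw (σ.restrictScalars ℚ_[p]) x
  have hωmul := cyclotomicChar_mul hζ hω
  have hdlt := card_algEquiv_lt hζ hKgen hω
  have hdpos : 0 < Nat.card (K ≃ₐ[F] K) := Nat.card_pos
  have hd : (Nat.card (K ≃ₐ[F] K) : ZMod p) ≠ 0 := by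
    rw [Ne, ZMod.natCast_eq_zero_iff]
    exact fun hdvd => absurd (Nat.le_of_dvd hdpos hdvd) (by omega)
  have hps : ¬ p ∣ s := fun hdvd => by
    have := Nat.le_of_dvd hdpos (h.dvd_card_algEquiv hσ hπ0 hπ hsdvd)
    have := Nat.le_of_dvd hs hdvd
    omega
  have hp1 : ((p - 1 : ℕ) : ℤ) = p - 1 := by push_cast [hp.out.one_le]; ring
  have hl0 : ζ - 1 ≠ 0 := sub_ne_zero.2 (hζ.ne_one hp.out.one_lt)
  have hR : ((p : ℤ) - 1) * e1s = (e * s : ℕ) := by rw [← he1s, Nat.cast_mul, hp1]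
  have hlam : w (ζ - 1) = e1s := by
    have h1 := h.mul_val_primitiveRoot_sub_one hζ
    rw [hwp, ← hR] at h1
    exact mul_left_cancel₀ (by omega) h1
  have hN : ((p * e1s : ℕ) : ℤ) = e1s + s * e := by
    push_cast at hR ⊢
    linear_combination hR
  set N : ℤ := ((p * e1s : ℕ) : ℤ) with hNdef
  intro i hi hie
  have hpos : 1 ≤ N - s * bExp p i := by
    have h1 : (p - 1) * bExp p i < p * e :=
      (mul_bExp_lt hp2 hi).trans_le (Nat.mul_le_mul_left p hie)
    have h2 : (p - 1) * (s * bExp p i) < (p - 1) * (p * e1s) := by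
      calc (p - 1) * (s * bExp p i) = s * ((p - 1) * bExp p i) := by ring
        _ < s * (p * e) := Nat.mul_lt_mul_of_pos_left h1 hs
        _ = p * (e * s) := by ring
        _ = (p - 1) * (p * e1s) := by rw [← he1s]; ring
    have h3 := lt_of_mul_lt_mul_left h2 (Nat.zero_le _)
    have h4 : ((s * bExp p i : ℕ) : ℤ) < N := by rw [hNdef]; exact_mod_cast h3
    push_cast at h4
    omega
  have hinter : ∀ {j : ℤ} (hj : 1 ≤ j), omegaEigenspace p F K ω ∩ UbarSet p K w j =
      h.eigenFil ω hj := fun hj => h.omegaEigenspace_inter_UbarSet hσ hωmul hd hj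
  constructor
  · have hj' : 1 ≤ N - s * bExp p i + 1 := by omega
    rw [hinter hpos, hinter hj']
    have h1 := Subgroup.relIndex_mul_relIndex ⊥ _ _ bot_le
      (h.eigenFil_anti (ω := ω) hpos (Int.le_add_one le_rfl))
    rw [Subgroup.relIndex_bot_left, Subgroup.relIndex_bot_left] at h1
    have hbpos : 0 < bExp p i := Nat.pos_of_ne_zero fun h0 =>
      not_dvd_bExp hp2 hi (h0 ▸ dvd_zero p)
    have hpj : ¬ (p : ℤ) ∣ N - s * bExp p i := fun hdvd => by
      have h2 : (p : ℤ) ∣ (s * bExp p i : ℕ) := by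
        have h3 : (p : ℤ) ∣ N := by rw [hNdef, Nat.cast_mul]; exact dvd_mul_right _ _
        simpa using dvd_sub h3 hdvd
      rcases hp.out.dvd_mul.1 (Int.natCast_dvd_natCast.1 h2) with h3 | h3
      · exact hps h3
      · exact not_dvd_bExp hp2 hi h3
    have hjR : N - s * bExp p i < p * w (ζ - 1) := by
      rw [hlam, hNdef]
      push_cast
      have : (0 : ℤ) < s * bExp p i := by positivity
      omega
    have h2 := h.relIndex_eigenFil hσ hpw hζ hω hd hodd hpos hjR hpj hj'
    have h3 := (h.comap (algebraMap F K)).relIndex_fil_of_dvd hs hsdvd hz0 hz (e - bExp p i)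
    have h4 := (h.comap (algebraMap F K)).relIndex_fil_eq_pow hs he hz0 hz hew hef
    have h5 : N - s * bExp p i - w (ζ - 1) = s * (e - bExp p i) := by rw [hlam, hN]; ring
    rw [add_sub_right_comm, h5, h3, h4] at h2
    rw [h2] at h1
    rw [mul_comm (p ^ f)]
    exact h1.symm
  · have step : ∀ j, N - bExp p i * s + 1 ≤ j → j < N - bExp p (i - 1) * s →
        omegaEigenspace p F K ω ∩ UbarSet p K w j =
          omegaEigenspace p F K ω ∩ UbarSet p K w (j + 1) := by
      intro j hj1 hj2
      have hj : 1 ≤ j := by linarith [mul_comm (s : ℤ) (bExp p i)]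
      rw [hinter hj, hinter (hj.trans (Int.le_add_one le_rfl))]
      by_cases hdvd : (s : ℤ) ∣ j - e1s
      · obtain ⟨t, ht⟩ := hdvd
        have hs' : (0 : ℤ) < s := by exact_mod_cast hs
        have hj3 : j = N - (e - t) * s := by rw [hN]; linear_combination ht
        rw [hj3] at hj1 hj2
        have hm1 : (bExp p (i - 1) : ℤ) < e - t := lt_of_mul_lt_mul_right (by omega) hs'.le
        have hm2 : e - t < (bExp p i : ℤ) := lt_of_mul_lt_mul_right (by omega) hs'.le
        obtain ⟨m, hm⟩ := Int.eq_ofNat_of_zero_le (a := e - t) (by omega)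
        rw [hm] at hm1 hm2 hj3
        obtain ⟨c, rfl⟩ := dvd_of_bExp_lt_of_lt_bExp hp2 hi (Int.ofNat_lt.1 hm1)
          (Int.ofNat_lt.1 hm2)
        obtain ⟨k, hk⟩ : ∃ k : ℤ, k = e1s - c * s := ⟨_, rfl⟩
        have hjk : j = p * k := by rw [hj3, hk, hNdef]; push_cast; ring
        have hk1 : 1 ≤ k := by
          by_contra! hk0
          nlinarith
        have hc : (0 : ℤ) < c := by
          have : 0 < c := Nat.pos_of_ne_zero (by rintro rfl; omega)
          exact_mod_cast this
        have hkR : k < e1s := by rw [hk]; nlinarith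
        subst hjk
        exact congrArg SetLike.coe
          (h.eigenFil_eq_of_dvd hodd hπ0 hπ (by rw [hR, hwp]) hpw hk1 hkR hj)
      · refine congrArg SetLike.coe
          (h.eigenFil_eq_of_forall_ne hσ hpw hζ hω hd hj fun a ha haj => hdvd ?_)
        rw [h.mul _ _ hl0 (by simpa using ha), hlam] at haj
        rw [← haj, add_sub_cancel_left]
        exact hsdvd a ha
    have hall : ∀ j, N - bExp p i * s + 1 ≤ j → j ≤ N - bExp p (i - 1) * s →
        omegaEigenspace p F K ω ∩ UbarSet p K w j =
          omegaEigenspace p F K ω ∩ UbarSet p K w (N - bExp p i * s + 1) := by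
      intro j hj
      induction j, hj using Int.leInduction with
      | base => exact fun _ => rfl
      | succ j hj ih =>
        intro hj'
        rw [← step j hj (by omega), ih (by omega)]
    refine hall _ ?_ le_rfl
    have hb : bExp p (i - 1) < bExp p i := by
      unfold bExp
      have := Nat.div_le_div_right (c := p - 1) (show i - 1 - 1 ≤ i - 1 by omega)
      omega
    have : (bExp p (i - 1) : ℤ) + 1 ≤ bExp p i := by exact_mod_cast hb
    have hle := mul_le_mul_of_nonneg_right this (Int.natCast_nonneg s)
    have hs' : (1 : ℤ) ≤ s := by exact_mod_cast hs
    rw [add_mul, one_mul] at hle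
    omega
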